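/- arXiv:2207.07401 — 9 statements merged into one kernel-verified Lean document; each statement's English description precedes it below -/
import Mathlib

section
/- Let κ be a regular uncountable cardinal and let 𝒰 be a κ-complete filter over κ containing every co-bounded subset of κ. Then the generalized Mathias forcing 𝕄_𝒰 is κ-directed-closed: every directed set D of conditions with |D| < κ (directed meaning any two members of D have a common extension in D) admits a single condition extending every member of D. -/
open Cardinal Set

noncomputable section

/-- `F` is a (proper) filter on the cardinal `κ`; subsets of `κ` are coded as
sets of ordinals below `κ.ord`. -/
def IsFilterOn (κ : Cardinal.{0}) (F : Set (Set Ordinal.{0})) : Prop :=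
  (∀ A ∈ F, A ⊆ Set.Iio κ.ord) ∧
  Set.Iio κ.ord ∈ F ∧
  (∅ : Set Ordinal) ∉ F ∧
  (∀ A ∈ F, ∀ B : Set Ordinal, B ⊆ Set.Iio κ.ord → A ⊆ B → B ∈ F) ∧
  (∀ A ∈ F, ∀ B ∈ F, A ∩ B ∈ F)

/-- `F` is `κ`-complete: closed under intersections of fewer than `κ` of its members. -/
def IsKappaComplete (κ : Cardinal.{0}) (F : Set (Set Ordinal.{0})) : Prop :=
  ∀ S : Set (Set Ordinal.{0}), S ⊆ F → S.Nonempty →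
    Cardinal.mk ↥S < Cardinal.lift.{1, 0} κ → ⋂₀ S ∈ F

/-- `F` contains every co-bounded subset of `κ`. -/
def ContainsCobounded (κ : Cardinal.{0}) (F : Set (Set Ordinal.{0})) : Prop :=
  ∀ γ < κ.ord, {x : Ordinal | γ ≤ x ∧ x < κ.ord} ∈ F

/-- `F` is an ultrafilter on `κ`. -/
def IsUltraOn (κ : Cardinal.{0}) (F : Set (Set Ordinal.{0})) : Prop :=
  IsFilterOn κ F ∧
  ∀ A : Set Ordinal, A ⊆ Set.Iio κ.ord → (A ∈ F ∨ Set.Iio κ.ord \ A ∈ F)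

/-- `x ⊆* A` modulo sets of size `< κ`. -/
def AlmostSub (κ : Cardinal.{0}) (x A : Set Ordinal.{0}) : Prop :=
  Cardinal.mk ↥(x \ A) < Cardinal.lift.{1, 0} κ

/-- Galvin's property `Gal(F, μ, ν)`: every `ν`-indexed family of members of `F`
admits a subfamily of `μ` many indices whose intersection belongs to `F`. -/
def GalvinProp (F : Set (Set Ordinal.{0})) (μ ν : Cardinal.{0}) : Prop :=
  ∀ C : Ordinal → Set Ordinal, (∀ γ < ν.ord, C γ ∈ F) →
    ∃ I : Set Ordinal, I ⊆ Set.Iio ν.ord ∧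
      Cardinal.mk ↥I = Cardinal.lift.{1, 0} μ ∧ (⋂ γ ∈ I, C γ) ∈ F

/-- A condition of the generalized Mathias forcing `𝕄_U`: a pair `(a, A)` with
`a ⊆ κ`, `|a| < κ`, `A ∈ U` and `sup a < min A`. -/
structure MathiasCond (κ : Cardinal.{0}) (U : Set (Set Ordinal.{0})) where
  a : Set Ordinal.{0}
  A : Set Ordinal.{0}
  a_sub : a ⊆ Set.Iio κ.ord
  a_small : Cardinal.mk ↥a < Cardinal.lift.{1, 0} κ
  A_mem : A ∈ U
  below : sSup a < sInf A

/-- `MathiasExt p q` : the condition `q` extends the condition `p`. -/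
def MathiasExt {κ : Cardinal.{0}} {U : Set (Set Ordinal.{0})}
    (p q : MathiasCond κ U) : Prop :=
  p.a ⊆ q.a ∧ q.A ⊆ p.A ∧ q.a \ p.a ⊆ p.A

/-- Below a regular cardinal, the supremum of a small set of ordinals stays below. -/
theorem sSup_lt_ord_of_mk_lt {κ : Cardinal.{0}} (hreg : κ.IsRegular) {a : Set Ordinal.{0}}
    (ha : a ⊆ Set.Iio κ.ord) (hsmall : Cardinal.mk ↥a < Cardinal.lift.{1, 0} κ) :
    sSup a < κ.ord := by
  refine Ordinal.sSup_lt_of_lt_cof ?_ ha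
  rwa [← Ordinal.lift_cof, hreg.cof_ord]

/-- The side sets of a small family of conditions, cut to a final segment, still meet in `U`. -/
theorem IsKappaComplete.exists_mem_subset {κ : Cardinal.{0}} {U : Set (Set Ordinal.{0})}
    (hκ : ℵ₀ ≤ κ) (hcomp : IsKappaComplete κ U) (hcb : ContainsCobounded κ U)
    {S : Set (Set Ordinal.{0})} (hS : S ⊆ U)
    (hsmall : Cardinal.mk ↥S < Cardinal.lift.{1, 0} κ) {γ : Ordinal.{0}} (hγ : γ < κ.ord) :
    ∃ A ∈ U, (∀ B ∈ S, A ⊆ B) ∧ ∀ x ∈ A, γ ≤ x := by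
  refine ⟨⋂₀ insert {x | γ ≤ x ∧ x < κ.ord} S, hcomp _ ?_ (insert_nonempty _ _) ?_, ?_, ?_⟩
  · exact insert_subset (hcb γ hγ) hS
  · have hκ' : ℵ₀ ≤ Cardinal.lift.{1, 0} κ := by simpa using hκ
    exact mk_insert_le.trans_lt (add_lt_of_lt hκ' hsmall (one_lt_aleph0.trans_le hκ'))
  · exact fun B hB => sInter_subset_of_mem (mem_insert_of_mem _ hB)
  · exact fun x hx => (mem_sInter.1 hx _ (mem_insert _ _)).1

/-- the generalized Mathias forcing `𝕄_U` is `κ`-directed-closed. -/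
theorem mathias_directed_closed (κ : Cardinal.{0}) (hreg : κ.IsRegular)
    (hunc : ℵ₀ < κ) (U : Set (Set Ordinal.{0})) (hfil : IsFilterOn κ U)
    (hcomp : IsKappaComplete κ U) (hcb : ContainsCobounded κ U)
    (D : Set (MathiasCond κ U))
    (hdir : ∀ p ∈ D, ∀ q ∈ D, ∃ r ∈ D, MathiasExt p r ∧ MathiasExt q r)
    (hsmall : Cardinal.mk ↥D < Cardinal.lift.{1, 0} κ) :
    ∃ r : MathiasCond κ U, ∀ p ∈ D, MathiasExt p r := by
  have hunion : ⋃ p ∈ D, p.a ⊆ Set.Iio κ.ord := iUnion₂_subset fun p _ => p.a_sub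
  have hcard : Cardinal.mk ↥(⋃ p ∈ D, p.a) < Cardinal.lift.{1, 0} κ :=
    (card_biUnion_lt_iff_forall_of_isRegular hreg.lift hsmall).2 fun p _ => p.a_small
  have hlimit : Order.IsSuccLimit κ.ord := isSuccLimit_ord hreg.aleph0_le
  obtain ⟨A, hAU, hAD, hAsup⟩ := hcomp.exists_mem_subset hreg.aleph0_le hcb
    (S := MathiasCond.A '' D) (image_subset_iff.2 fun p _ => p.A_mem)
    (mk_image_le.trans_lt hsmall)
    (hlimit.succ_lt (sSup_lt_ord_of_mk_lt hreg hunion hcard))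
  have hAne : A.Nonempty := nonempty_iff_ne_empty.2 fun h => hfil.2.2.1 (h ▸ hAU)
  refine ⟨⟨⋃ p ∈ D, p.a, A, hunion, hcard, hAU,
    Order.succ_le_iff.1 (hAsup _ (csInf_mem hAne))⟩, fun p hp =>
    ⟨subset_biUnion_of_mem (u := MathiasCond.a) hp, hAD _ (mem_image_of_mem _ hp), ?_⟩⟩
  rintro x ⟨hx, hxp⟩
  obtain ⟨q, hq, hxq⟩ := mem_iUnion₂.1 hx
  obtain ⟨r, -, hpr, hqr⟩ := hdir p hp q hq
  exact hpr.2.2 ⟨hqr.1 hxq, hxp⟩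
end
end

section
/- Let κ be a regular uncountable cardinal and let 𝒰 be a κ-complete filter over κ containing every co-bounded subset of κ. Then the generalized Mathias forcing 𝕄_𝒰 is countably parallel closed: whenever ⟨p_n : n < ω⟩ and ⟨q_n : n < ω⟩ are two sequences of conditions, each increasing in the extension order, such that p_n and q_n have a common extension for every n < ω, then there is a single condition extending every p_n and every q_n. -/
open Cardinal Set

noncomputable section

/-- The supremum of the stem of a Mathias condition lies strictly below `κ`. -/
theorem MathiasCond.sSup_lt {κ : Cardinal.{0}} {U : Set (Set Ordinal.{0})}
    (hfil : IsFilterOn κ U) (p : MathiasCond κ U) : sSup p.a < κ.ord := by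
  obtain ⟨x, hx⟩ : p.A.Nonempty :=
    nonempty_iff_ne_empty.2 fun h => hfil.2.2.1 (h ▸ p.A_mem)
  exact (p.below.trans_le (csInf_le' hx)).trans (hfil.1 _ p.A_mem hx)

/-- The supremum of the stem of a Mathias condition bounds the stem. -/
theorem MathiasCond.le_sSup {κ : Cardinal.{0}} {U : Set (Set Ordinal.{0})}
    (p : MathiasCond κ U) {x : Ordinal.{0}} (hx : x ∈ p.a) : x ≤ sSup p.a :=
  le_csSup ⟨κ.ord, fun _ hy => (p.a_sub hy).le⟩ hx

/-- Extension of Mathias conditions is transitive. -/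
theorem MathiasExt.trans {κ : Cardinal.{0}} {U : Set (Set Ordinal.{0})}
    {p q r : MathiasCond κ U} (hpq : MathiasExt p q) (hqr : MathiasExt q r) :
    MathiasExt p r := by
  refine ⟨hpq.1.trans hqr.1, hqr.2.1.trans hpq.2.1, fun x hx => ?_⟩
  by_cases hxq : x ∈ q.a
  · exact hpq.2.2 ⟨hxq, hx.2⟩
  · exact hpq.2.1 (hqr.2.2 ⟨hx.1, hxq⟩)

/-- A countable family of Mathias conditions has a common extension as soon as the stem of
each condition is allowed by every other condition. -/
theorem exists_mathiasExt_of_countable {κ : Cardinal.{0}} (hreg : κ.IsRegular)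
    (hunc : ℵ₀ < κ) {U : Set (Set Ordinal.{0})} (hfil : IsFilterOn κ U)
    (hcomp : IsKappaComplete κ U) (hcb : ContainsCobounded κ U)
    {ι : Type} [Countable ι] [Nonempty ι] (s : ι → MathiasCond κ U)
    (hs : ∀ i j, (s j).a \ (s i).a ⊆ (s i).A) :
    ∃ r : MathiasCond κ U, ∀ i, MathiasExt (s i) r := by
  set γ : Ordinal.{0} := ⨆ i, sSup (s i).a
  have hγκ : γ < κ.ord :=
    Ordinal.iSup_lt_of_lt_cof (by rw [hreg.cof_ord]; exact mk_le_aleph0.trans_lt hunc)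
      fun i => (s i).sSup_lt hfil
  have hγ_succ : Order.succ γ < κ.ord := (isSuccLimit_ord hreg.aleph0_le).succ_lt hγκ
  have hle : ∀ x ∈ ⋃ i, (s i).a, x ≤ γ := fun x hx => by
    obtain ⟨i, hi⟩ := mem_iUnion.1 hx
    exact ((s i).le_sSup hi).trans (Ordinal.le_iSup (fun i => sSup (s i).a) i)
  have hA : (⋂₀ range fun i => (s i).A) ∈ U := by
    refine hcomp _ ?_ (range_nonempty _) ?_
    · rintro _ ⟨i, rfl⟩
      exact (s i).A_mem
    · exact (countable_range _).le_aleph0.trans_lt (by simpa using hunc)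
  have hAγ := hfil.2.2.2.2 _ hA _ (hcb _ hγ_succ)
  refine ⟨⟨⋃ i, (s i).a, _, iUnion_subset fun i => (s i).a_sub, ?_, hAγ, ?_⟩, fun i =>
    ⟨subset_iUnion (fun i => (s i).a) i, fun x hx => hx.1 _ ⟨i, rfl⟩, ?_⟩⟩
  · calc #(⋃ i, (s i).a) ≤ #(Iio (Order.succ γ)) :=
          mk_le_mk_of_subset fun x hx => Order.lt_succ_of_le (hle x hx)
      _ = Cardinal.lift.{1, 0} (Order.succ γ).card := mk_Iio_ordinal _
      _ < Cardinal.lift.{1, 0} κ := Cardinal.lift_lt.2 (lt_ord.1 hγ_succ)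
  · have hne := nonempty_iff_ne_empty.2 fun h => hfil.2.2.1 (h ▸ hAγ)
    exact (csSup_le' hle).trans_lt
      ((Order.lt_succ γ).trans_le (le_csInf hne fun x hx => hx.2.1))
  · rintro x ⟨hx, hxi⟩
    obtain ⟨j, hj⟩ := mem_iUnion.1 hx
    exact hs i j ⟨hj, hxi⟩

/-- the generalized Mathias forcing `𝕄_U` is countably parallel
closed: two pointwise compatible increasing `ω`-sequences of conditions have a
common upper bound. -/
theorem mathias_countably_parallel_closed (κ : Cardinal.{0}) (hreg : κ.IsRegular)
    (hunc : ℵ₀ < κ) (U : Set (Set Ordinal.{0})) (hfil : IsFilterOn κ U)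
    (hcomp : IsKappaComplete κ U) (hcb : ContainsCobounded κ U)
    (p q : ℕ → MathiasCond κ U)
    (hp : ∀ m n : ℕ, m ≤ n → MathiasExt (p m) (p n))
    (hq : ∀ m n : ℕ, m ≤ n → MathiasExt (q m) (q n))
    (hpar : ∀ n : ℕ, ∃ r : MathiasCond κ U, MathiasExt (p n) r ∧ MathiasExt (q n) r) :
    ∃ r : MathiasCond κ U, (∀ n, MathiasExt (p n) r) ∧ (∀ n, MathiasExt (q n) r) := by
  have stem_sub : ∀ {s t : ℕ → MathiasCond κ U},
      (∀ m n : ℕ, m ≤ n → MathiasExt (s m) (s n)) →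
      (∀ m n : ℕ, m ≤ n → MathiasExt (t m) (t n)) →
      (∀ n : ℕ, ∃ r : MathiasCond κ U, MathiasExt (s n) r ∧ MathiasExt (t n) r) →
      ∀ m n : ℕ, (t n).a \ (s m).a ⊆ (s m).A := by
    rintro s t hs ht hst m n x ⟨hx, hxm⟩
    obtain ⟨r, hsr, htr⟩ := hst (max m n)
    exact ((hs m _ (le_max_left m n)).trans hsr).2.2
      ⟨((ht n _ (le_max_right m n)).trans htr).1 hx, hxm⟩
  have self_compat : ∀ {s : ℕ → MathiasCond κ U},
      (∀ m n : ℕ, m ≤ n → MathiasExt (s m) (s n)) →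
      ∀ n : ℕ, ∃ r : MathiasCond κ U, MathiasExt (s n) r ∧ MathiasExt (s n) r :=
    fun {s} hs n => ⟨s n, hs n n le_rfl, hs n n le_rfl⟩
  obtain ⟨r, hr⟩ := exists_mathiasExt_of_countable hreg hunc hfil hcomp hcb (Sum.elim p q) (by
    rintro (m | m) (n | n)
    · exact stem_sub hp hp (self_compat hp) m n
    · exact stem_sub hp hq hpar m n
    · exact stem_sub hq hp (fun k => (hpar k).imp fun _ h => h.symm) m n
    · exact stem_sub hq hq (self_compat hq) m n)
  exact ⟨r, fun n => hr (Sum.inl n), fun n => hr (Sum.inr n)⟩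
end
end

section
/- Let κ be a regular uncountable cardinal, let 𝒰 be a κ-complete filter over κ, and suppose x ⊆ κ is unbounded in κ and diagonalizes 𝒰, i.e. x ⊆* A for every A ∈ 𝒰. Then 𝒰* := {A ⊆ κ : x ⊆* A} is a proper κ-complete filter on κ, 𝒰 ⊆ 𝒰*, and Gal(𝒰*, κ, κ⁺) holds. -/
open Cardinal Set

noncomputable section

/-- The filter `{A ⊆ κ | x ⊆* A}` generated by a diagonalizing set `x`. -/
def DiagFilter (κ : Cardinal.{0}) (x : Set Ordinal.{0}) : Set (Set Ordinal.{0}) :=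
  {A | A ⊆ Set.Iio κ.ord ∧ AlmostSub κ x A}

theorem bounded_of_mk_lt {κ : Cardinal.{0}} (hreg : κ.IsRegular) {s : Set Ordinal.{0}}
    (hs : s ⊆ Set.Iio κ.ord) (hcard : #s < Cardinal.lift.{1, 0} κ) :
    ∃ δ < κ.ord, ∀ y ∈ s, y < δ := by
  have hsup : sSup s < κ.ord := by
    refine Ordinal.sSup_lt_of_lt_cof ?_ hs
    rwa [← Ordinal.lift_cof, hreg.cof_ord]
  have hbdd : BddAbove s := ⟨κ.ord, fun y hy => (hs hy).le⟩
  exact ⟨Order.succ (sSup s), (isSuccLimit_ord hreg.aleph0_le).succ_lt hsup,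
    fun y hy => Order.lt_succ_of_le (le_csSup hbdd hy)⟩

theorem mk_Iio_lt_lift {κ : Cardinal.{0}} {δ : Ordinal.{0}} (hδ : δ < κ.ord) :
    #(Set.Iio δ) < Cardinal.lift.{1, 0} κ := by
  rw [mk_Iio_ordinal, lift_lt]
  exact lt_ord.1 hδ

/-- For regular `κ`, inclusion modulo sets of size `< κ` is inclusion on a final segment. -/
theorem almostSub_iff_eventually {κ : Cardinal.{0}} (hreg : κ.IsRegular)
    {x A : Set Ordinal.{0}} (hx : x ⊆ Set.Iio κ.ord) :
    AlmostSub κ x A ↔ ∃ δ < κ.ord, ∀ y ∈ x, δ ≤ y → y ∈ A := by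
  constructor
  · intro h
    obtain ⟨δ, hδ, hb⟩ := bounded_of_mk_lt hreg (sdiff_subset.trans hx) h
    refine ⟨δ, hδ, fun y hy hle => ?_⟩
    by_contra hA
    exact (hb y ⟨hy, hA⟩).not_ge hle
  · rintro ⟨δ, hδ, h⟩
    refine (mk_le_mk_of_subset fun y hy => ?_).trans_lt (mk_Iio_lt_lift hδ)
    by_contra hle
    exact hy.2 (h y hy.1 (not_lt.1 hle))

theorem isFilterOn_diagFilter {κ : Cardinal.{0}} (hreg : κ.IsRegular)
    {x : Set Ordinal.{0}} (hx : x ⊆ Set.Iio κ.ord)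
    (hunb : ∀ γ < κ.ord, ∃ y ∈ x, γ ≤ y) : IsFilterOn κ (DiagFilter κ x) := by
  refine ⟨fun A hA => hA.1, ⟨Subset.rfl, ?_⟩, fun h => ?_, fun A hA B hB hAB => ⟨hB, ?_⟩,
    fun A hA B hB => ⟨inter_subset_left.trans hA.1, ?_⟩⟩
  · exact (almostSub_iff_eventually hreg hx).2 ⟨0, hreg.ord_pos, fun y hy _ => hx hy⟩
  · obtain ⟨δ, hδ, h⟩ := (almostSub_iff_eventually hreg hx).1 h.2
    obtain ⟨y, hy, hle⟩ := hunb δ hδ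
    exact h y hy hle
  · exact (mk_le_mk_of_subset (sdiff_subset_sdiff_right hAB)).trans_lt hA.2
  · obtain ⟨δ, hδ, hA⟩ := (almostSub_iff_eventually hreg hx).1 hA.2
    obtain ⟨ε, hε, hB⟩ := (almostSub_iff_eventually hreg hx).1 hB.2
    exact (almostSub_iff_eventually hreg hx).2 ⟨max δ ε, max_lt hδ hε, fun y hy hle =>
      ⟨hA y hy ((le_max_left _ _).trans hle), hB y hy ((le_max_right _ _).trans hle)⟩⟩

theorem isKappaComplete_diagFilter {κ : Cardinal.{0}} (hreg : κ.IsRegular)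
    {x : Set Ordinal.{0}} (hx : x ⊆ Set.Iio κ.ord) : IsKappaComplete κ (DiagFilter κ x) := by
  intro S hS ⟨A₀, hA₀⟩ hcard
  have hev : ∀ A : S, ∃ δ < κ.ord, ∀ y ∈ x, δ ≤ y → y ∈ (A : Set Ordinal) :=
    fun A => (almostSub_iff_eventually hreg hx).1 (hS A.2).2
  choose f hf hfA using hev
  obtain ⟨δ, hδ, hb⟩ := bounded_of_mk_lt hreg (range_subset_iff.2 hf)
    (mk_range_le.trans_lt hcard)
  exact ⟨(sInter_subset_of_mem hA₀).trans (hS hA₀).1,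
    (almostSub_iff_eventually hreg hx).2 ⟨δ, hδ, fun y hy hle A hA =>
      hfA ⟨A, hA⟩ y hy ((hb _ ⟨⟨A, hA⟩, rfl⟩).le.trans hle)⟩⟩

theorem galvinProp_diagFilter {κ : Cardinal.{0}} (hreg : κ.IsRegular)
    {x : Set Ordinal.{0}} (hx : x ⊆ Set.Iio κ.ord) :
    GalvinProp (DiagFilter κ x) κ (Order.succ κ) := by
  intro C hC
  have hev : ∀ γ : Set.Iio (Order.succ κ).ord, ∃ δ : Set.Iio κ.ord,
      ∀ y ∈ x, (δ : Ordinal) ≤ y → y ∈ C γ := fun γ => by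
    obtain ⟨δ, hδ, h⟩ := (almostSub_iff_eventually hreg hx).1 (hC γ γ.2).2
    exact ⟨⟨δ, hδ⟩, h⟩
  choose f hf using hev
  obtain ⟨δ, hδ⟩ := infinite_pigeonhole_card_lt f
    (by simp [mk_Iio_ordinal])
    (by rw [mk_Iio_ordinal, card_ord, aleph0_le_lift]; exact hreg.aleph0_le.trans (Order.le_succ κ))
  have hle : Cardinal.lift.{1, 0} κ ≤ #(Subtype.val '' (f ⁻¹' {δ})) := by
    rw [mk_image_eq Subtype.val_injective]
    simpa [mk_Iio_ordinal] using hδ.le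
  obtain ⟨I, hI, hIcard⟩ := le_mk_iff_exists_subset.1 hle
  have hInonempty : I.Nonempty := by
    rw [← nonempty_coe_sort, ← mk_ne_zero_iff, hIcard]
    simpa using hreg.pos.ne'
  obtain ⟨γ₀, hγ₀⟩ := hInonempty
  have hIsub : I ⊆ Set.Iio (Order.succ κ).ord := hI.trans (Subtype.coe_image_subset _ _)
  refine ⟨I, hIsub, hIcard, (biInter_subset_of_mem hγ₀).trans (hC γ₀ (hIsub hγ₀)).1,
    (almostSub_iff_eventually hreg hx).2 ⟨δ, δ.2, fun y hy hle => mem_iInter₂.2 fun γ hγ => ?_⟩⟩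
  obtain ⟨γ, rfl, rfl⟩ := hI hγ
  exact hf γ y hy hle

/-- if `x` is unbounded in `κ` and diagonalizes the `κ`-complete
filter `U`, then `U* = {A | x ⊆* A}` is a proper `κ`-complete filter extending
`U` and `Gal(U*, κ, κ⁺)` holds. -/
theorem diagonalized_filter_Galvin (κ : Cardinal.{0}) (hreg : κ.IsRegular)
    (hunc : ℵ₀ < κ) (U : Set (Set Ordinal.{0})) (hfil : IsFilterOn κ U)
    (hcomp : IsKappaComplete κ U)
    (x : Set Ordinal.{0}) (hxsub : x ⊆ Set.Iio κ.ord)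
    (hxunb : ∀ γ < κ.ord, ∃ y ∈ x, γ ≤ y)
    (hdiag : ∀ A ∈ U, AlmostSub κ x A) :
    IsFilterOn κ (DiagFilter κ x) ∧ IsKappaComplete κ (DiagFilter κ x) ∧
    U ⊆ DiagFilter κ x ∧ GalvinProp (DiagFilter κ x) κ (Order.succ κ) := by
  exact ⟨isFilterOn_diagFilter hreg hxsub hxunb, isKappaComplete_diagFilter hreg hxsub,
    fun A hA => ⟨hfil.1 A hA, hdiag A hA⟩, galvinProp_diagFilter hreg hxsub⟩
end
end

section
/- Let κ be a regular uncountable cardinal and let 𝒰 be a κ-complete ultrafilter over κ containing every co-bounded subset of κ. Suppose 𝒰 admits a strong generating sequence of length κ⁺, i.e. a sequence ⟨A_α : α < κ⁺⟩ of members of 𝒰 that is ⊆*-decreasing (A_β ⊆* A_α for α < β) and such that for every X ∈ 𝒰 there is α < κ⁺ with A_α ⊆* X. Then 𝒰 is a P-point: every sequence ⟨X_α : α < κ⟩ of members of 𝒰 admits a pseudo-intersection in 𝒰, i.e. some X ∈ 𝒰 with X ⊆* X_α for every α < κ. -/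
open Cardinal Set

noncomputable section

theorem AlmostSub.trans {κ : Cardinal.{0}} (hκ : ℵ₀ ≤ κ) {x y z : Set Ordinal.{0}}
    (hxy : AlmostSub κ x y) (hyz : AlmostSub κ y z) : AlmostSub κ x z := by
  have hsub : x \ z ⊆ (x \ y) ∪ (y \ z) := fun a ⟨hx, hz⟩ => by
    by_cases hy : a ∈ y
    · exact Or.inr ⟨hy, hz⟩
    · exact Or.inl ⟨hx, hy⟩
  exact (Cardinal.mk_le_mk_of_subset hsub).trans_lt ((Cardinal.mk_union_le _ _).trans_lt
    (Cardinal.add_lt_of_lt (Cardinal.aleph0_le_lift.2 hκ) hxy hyz))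

/-- A `κ`-indexed family of ordinals below `κ⁺` is strictly bounded below `κ⁺`. -/
theorem exists_forall_lt_of_lt_ord_succ {κ : Cardinal.{0}} (hκ : ℵ₀ ≤ κ)
    (f : Set.Iio κ.ord → Ordinal.{0}) (hf : ∀ i, f i < (Order.succ κ).ord) :
    ∃ γ < (Order.succ κ).ord, ∀ i, f i < γ := by
  refine ⟨⨆ i, f i + 1, Ordinal.lift_iSup_add_one_lt_of_lt_cof ?_ hf,
    Ordinal.lt_iSup_add_one f⟩
  rw [← Ordinal.lift_cof, (Cardinal.isRegular_succ hκ).cof_ord, Cardinal.mk_Iio_ordinal,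
    Cardinal.card_ord, Cardinal.lift_lift, Cardinal.lift_lt]
  exact Order.lt_succ κ

/-- a `κ`-complete ultrafilter with a strong generating sequence of
length `κ⁺` is a P-point: every `κ`-sequence of members admits a
pseudo-intersection in the ultrafilter. -/
theorem strong_generating_seq_ppoint (κ : Cardinal.{0}) (hreg : κ.IsRegular)
    (hunc : ℵ₀ < κ) (U : Set (Set Ordinal.{0})) (hult : IsUltraOn κ U)
    (hcomp : IsKappaComplete κ U) (hcb : ContainsCobounded κ U)
    (A : Ordinal → Set Ordinal.{0})
    (hmem : ∀ α < (Order.succ κ).ord, A α ∈ U)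
    (hdec : ∀ α β : Ordinal, α < β → β < (Order.succ κ).ord → AlmostSub κ (A β) (A α))
    (hgen : ∀ X ∈ U, ∃ α < (Order.succ κ).ord, AlmostSub κ (A α) X) :
    ∀ X : Ordinal → Set Ordinal.{0}, (∀ α < κ.ord, X α ∈ U) →
      ∃ Y ∈ U, ∀ α < κ.ord, AlmostSub κ Y (X α) := by
  intro X hX
  choose f hf hfX using fun i : Set.Iio κ.ord => hgen (X i) (hX i i.2)
  obtain ⟨γ, hγ, hfγ⟩ := exists_forall_lt_of_lt_ord_succ hunc.le f hf
  exact ⟨A γ, hmem γ hγ, fun α hα =>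
    (hdec _ γ (hfγ ⟨α, hα⟩) hγ).trans hunc.le (hfX ⟨α, hα⟩)⟩
end
end

section
/- Let κ be a regular uncountable cardinal and let 𝒰 be a κ-complete ultrafilter over κ containing every co-bounded subset of κ. Then the following are equivalent: (i) every function f : κ → κ that is not constant mod 𝒰 is 1-1 mod 𝒰; (ii) every sequence ⟨X_α : α < κ⟩ of members of 𝒰 has a pseudo-intersection in 𝒰, i.e. some X ∈ 𝒰 with X ⊆* X_α for every α < κ. -/
open Cardinal Set

noncomputable section

/-- `f : κ → κ` is constant modulo the ultrafilter `W`. -/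
def ConstantMod (κ : Cardinal.{0}) (W : Set (Set Ordinal.{0}))
    (f : Ordinal → Ordinal) : Prop :=
  ∃ γ < κ.ord, {x : Ordinal | x < κ.ord ∧ f x = γ} ∈ W

/-- `f : κ → κ` is one-to-one modulo the ultrafilter `W`. -/
def OneOneMod (κ : Cardinal.{0}) (W : Set (Set Ordinal.{0}))
    (f : Ordinal → Ordinal) : Prop :=
  ∃ X ∈ W, ∀ γ < κ.ord,
    Cardinal.mk ↥{x ∈ X | f x = γ} < Cardinal.lift.{1, 0} κ

/-- `W` is a P-point: every `f : κ → κ` not constant mod `W` is one-to-one mod `W`. -/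
def IsPPoint (κ : Cardinal.{0}) (W : Set (Set Ordinal.{0})) : Prop :=
  ∀ f : Ordinal → Ordinal, (∀ x < κ.ord, f x < κ.ord) →
    ¬ ConstantMod κ W f → OneOneMod κ W f

/-- If `κ` is regular and every fiber of `f` on `X` has size `< κ`, then so does the part of `X`
where `f` is bounded by a given `α < κ`. -/
theorem mk_setOf_le_lt_of_fibers {κ : Cardinal.{0}} (hreg : κ.IsRegular) {X : Set Ordinal.{0}}
    {f : Ordinal.{0} → Ordinal.{0}} {α : Ordinal.{0}} (hα : α < κ.ord)
    (hf : ∀ γ < κ.ord, Cardinal.mk ↥{x ∈ X | f x = γ} < Cardinal.lift.{1, 0} κ) :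
    Cardinal.mk ↥{x ∈ X | f x ≤ α} < Cardinal.lift.{1, 0} κ := by
  have hs : Cardinal.mk ↥(Set.Iio (Order.succ α)) < Cardinal.lift.{1, 0} κ := by
    rw [Cardinal.mk_Iio_ordinal, Cardinal.lift_lt, ← Cardinal.lt_ord]
    exact (Cardinal.isSuccLimit_ord hreg.aleph0_le).succ_lt hα
  have hU := (Cardinal.card_biUnion_lt_iff_forall_of_isRegular
    (t := fun γ (_ : γ ∈ Set.Iio (Order.succ α)) => {x ∈ X | f x = γ}) hreg.lift hs).2
    fun γ hγ => hf γ ((Order.lt_succ_iff.1 hγ).trans_lt hα)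
  refine (Cardinal.mk_le_mk_of_subset ?_).trans_lt hU
  rintro x ⟨hx, hle⟩
  exact Set.mem_biUnion (Order.lt_succ_iff.2 hle) ⟨hx, rfl⟩

/-- for a `κ`-complete ultrafilter `U` over regular uncountable `κ`
containing the co-bounded sets, being a P-point is equivalent to every
`κ`-sequence of members of `U` having a pseudo-intersection in `U`. -/
theorem ppoint_iff_pseudoIntersection (κ : Cardinal.{0}) (hreg : κ.IsRegular)
    (hunc : ℵ₀ < κ) (U : Set (Set Ordinal.{0})) (hult : IsUltraOn κ U)
    (hcomp : IsKappaComplete κ U) (hcb : ContainsCobounded κ U) :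
    IsPPoint κ U ↔
      ∀ X : Ordinal → Set Ordinal.{0}, (∀ α < κ.ord, X α ∈ U) →
        ∃ Y ∈ U, ∀ α < κ.ord, AlmostSub κ Y (X α) := by
  obtain ⟨⟨hsub, -, hempty, hup, hinter⟩, hdich⟩ := hult
  constructor
  · intro hP X hX
    let B : Set Ordinal := {x | x < κ.ord ∧ ∃ α < κ.ord, x ∉ X α}
    rcases hdich B (fun x hx => hx.1) with hB | hB
    · let f : Ordinal → Ordinal := fun x => sInf {α | α < κ.ord ∧ x ∉ X α}
      have hfB : ∀ x ∈ B, f x < κ.ord ∧ x ∉ X (f x) := fun x hx =>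
        csInf_mem (s := {α | α < κ.ord ∧ x ∉ X α}) hx.2
      have hf : ∀ x < κ.ord, f x < κ.ord := by
        intro x hx
        by_cases hxB : x ∈ B
        · exact (hfB x hxB).1
        · have hfx : {α | α < κ.ord ∧ x ∉ X α} = ∅ :=
            Set.eq_empty_of_forall_notMem fun α hα => hxB ⟨hx, α, hα⟩
          simpa only [f, hfx, Ordinal.sInf_empty] using hreg.ord_pos
      have hconst : ¬ ConstantMod κ U f := by
        rintro ⟨γ, hγ, hU⟩
        refine hempty ?_
        convert hinter _ (hinter _ hU _ hB) _ (hX γ hγ)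
        refine (Set.eq_empty_of_forall_notMem ?_).symm
        rintro x ⟨⟨⟨-, rfl⟩, hxB⟩, hxX⟩
        exact (hfB x hxB).2 hxX
      obtain ⟨Z, hZ, hZf⟩ := hP f hf hconst
      refine ⟨Z ∩ B, hinter _ hZ _ hB, fun α hα => ?_⟩
      refine (Cardinal.mk_le_mk_of_subset ?_).trans_lt (mk_setOf_le_lt_of_fibers hreg hα hZf)
      rintro x ⟨⟨hxZ, -⟩, hxX⟩
      exact ⟨hxZ, csInf_le' ⟨hα, hxX⟩⟩
    · refine ⟨_, hB, fun α hα => ?_⟩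
      have hdiff : (Set.Iio κ.ord \ B) \ X α = ∅ :=
        Set.eq_empty_of_forall_notMem fun x hx => hx.1.2 ⟨hx.1.1, α, hα, hx.2⟩
      simpa only [AlmostSub, hdiff, Cardinal.mk_eq_zero] using hreg.lift.pos
  · intro hpi f _ hconst
    obtain ⟨Y, hY, hYX⟩ := hpi (fun γ => Set.Iio κ.ord \ {x | x < κ.ord ∧ f x = γ}) fun γ hγ =>
      (hdich _ fun x hx => hx.1).resolve_left fun h => hconst ⟨γ, hγ, h⟩
    refine ⟨Y, hY, fun γ hγ => (Cardinal.mk_le_mk_of_subset ?_).trans_lt (hYX γ hγ)⟩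
    rintro x ⟨hxY, hfx⟩
    exact ⟨hxY, fun hx => hx.2 ⟨hsub Y hY hxY, hfx⟩⟩
end
end

section
/- Let κ be a measurable cardinal, i.e. an uncountable cardinal carrying a κ-complete ultrafilter that contains every co-bounded subset of κ. Then there exists a κ-complete ultrafilter 𝒲 over κ containing every co-bounded subset of κ which is not a P-point, i.e. there is a function f : κ → κ that is neither constant mod 𝒲 nor 1-1 mod 𝒲. -/
open Cardinal Set

noncomputable section

/-- The product of `U` with itself, transported to `κ` along a pairing function `p`. -/
def pairProduct (κ : Cardinal.{0}) (U : Set (Set Ordinal.{0}))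
    (p : Ordinal.{0} → Ordinal.{0} → Ordinal.{0}) : Set (Set Ordinal.{0}) :=
  {A | A ⊆ Set.Iio κ.ord ∧
    {a | a < κ.ord ∧ {b | b < κ.ord ∧ p a b ∈ A} ∈ U} ∈ U}

theorem exists_pairing {κ : Cardinal.{0}} (hκ : ℵ₀ ≤ κ) :
    ∃ (p : Ordinal.{0} → Ordinal.{0} → Ordinal.{0}) (q : Ordinal.{0} → Ordinal.{0}),
      (∀ a < κ.ord, ∀ b < κ.ord, p a b < κ.ord) ∧
      (∀ a < κ.ord, ∀ b < κ.ord, q (p a b) = a) ∧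
      (∀ a < κ.ord, Set.InjOn (p a) (Set.Iio κ.ord)) ∧
      ∀ x < κ.ord, q x < κ.ord := by
  have hmk : Cardinal.mk ↥(Set.Iio κ.ord) = Cardinal.lift.{1, 0} κ := by
    rw [Cardinal.mk_Iio_ordinal, Cardinal.card_ord]
  have hprod : Cardinal.mk (↥(Set.Iio κ.ord) × ↥(Set.Iio κ.ord)) =
      Cardinal.mk ↥(Set.Iio κ.ord) := by
    rw [Cardinal.mk_prod, Cardinal.lift_id, hmk]
    exact Cardinal.mul_eq_self (Cardinal.aleph0_le_lift.2 hκ)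
  obtain ⟨e⟩ := Cardinal.eq.1 hprod
  refine ⟨fun a b => if h : a < κ.ord ∧ b < κ.ord then e (⟨a, h.1⟩, ⟨b, h.2⟩) else 0,
    fun x => if h : x < κ.ord then (e.symm ⟨x, h⟩).1 else 0, ?_, ?_, ?_, ?_⟩
  · intro a ha b hb
    simpa only [ha, hb, and_self, dite_true, Set.mem_Iio] using (e (⟨a, ha⟩, ⟨b, hb⟩)).2
  · intro a ha b hb
    have h := (e (⟨a, ha⟩, ⟨b, hb⟩)).2
    rw [Set.mem_Iio] at h
    simp [ha, hb, h]
  · intro a ha b hb c hc hbc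
    rw [Set.mem_Iio] at hb hc
    exact congrArg Subtype.val (by simpa [ha, hb, hc, Subtype.coe_inj] using hbc :
      (⟨b, hb⟩ : ↥(Set.Iio κ.ord)) = ⟨c, hc⟩)
  · intro x hx
    simpa only [hx, dite_true, Set.mem_Iio] using (e.symm ⟨x, hx⟩).1.2

theorem IsKappaComplete.forall_mem {κ : Cardinal.{0}} {U : Set (Set Ordinal.{0})}
    (hU : IsFilterOn κ U) (hc : IsKappaComplete κ U) {ι : Type 1} [Nonempty ι]
    (hι : Cardinal.mk ι < Cardinal.lift.{1, 0} κ) {F : ι → Set Ordinal.{0}}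
    (hF : ∀ i, F i ∈ U) : {x | x < κ.ord ∧ ∀ i, x ∈ F i} ∈ U := by
  have h := hc (Set.range F) (by rintro _ ⟨i, rfl⟩; exact hF i) (Set.range_nonempty F)
    (Cardinal.mk_range_le.trans_lt hι)
  refine hU.2.2.2.1 _ h _ (fun x hx => hx.1) fun x hx => ?_
  rw [Set.sInter_range, Set.mem_iInter] at hx
  exact ⟨hU.1 _ (hF (Classical.arbitrary ι)) (hx _), hx⟩

theorem singleton_notMem {κ : Cardinal.{0}} {U : Set (Set Ordinal.{0})} (hκ : ℵ₀ ≤ κ)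
    (hU : IsFilterOn κ U) (hb : ContainsCobounded κ U) (a : Ordinal.{0}) : {a} ∉ U := by
  intro h
  have ha : a < κ.ord := hU.1 _ h rfl
  have h' := hU.2.2.2.2 _ h _ (hb _ ((Cardinal.isSuccLimit_ord hκ).succ_lt ha))
  refine hU.2.2.1 ?_
  convert h'
  ext x
  simp only [Set.mem_empty_iff_false, Set.mem_inter_iff, Set.mem_singleton_iff,
    Set.mem_ofPred_eq, false_iff, not_and]
  rintro rfl h1
  exact absurd (Order.lt_succ x) (not_lt.2 h1)

theorem lift_le_mk_of_mem {κ : Cardinal.{0}} {U : Set (Set Ordinal.{0})} (hκ : ℵ₀ ≤ κ)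
    (hU : IsUltraOn κ U) (hc : IsKappaComplete κ U) (hb : ContainsCobounded κ U)
    {A : Set Ordinal.{0}} (hA : A ∈ U) : Cardinal.lift.{1, 0} κ ≤ Cardinal.mk ↥A := by
  by_contra! hlt
  have hne : A.Nonempty := by
    rw [Set.nonempty_iff_ne_empty]
    rintro rfl
    exact hU.1.2.2.1 hA
  have := hne.to_subtype
  have hcompl : ∀ a : A, Set.Iio κ.ord \ {a.1} ∈ U := fun a =>
    (hU.2 {a.1} (Set.singleton_subset_iff.2 (hU.1.1 _ hA a.2))).resolve_left
      (singleton_notMem hκ hU.1 hb _)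
  have h := hU.1.2.2.2.2 _ hA _ (hc.forall_mem hU.1 hlt hcompl)
  refine hU.1.2.2.1 ?_
  convert h
  ext x
  simp only [Set.mem_empty_iff_false, false_iff]
  rintro ⟨hx, -, hx'⟩
  exact (hx' ⟨x, hx⟩).2 rfl

section pairProduct

variable {κ : Cardinal.{0}} {U : Set (Set Ordinal.{0})}
  {p : Ordinal.{0} → Ordinal.{0} → Ordinal.{0}}

theorem isFilterOn_pairProduct (hU : IsFilterOn κ U)
    (hp : ∀ a < κ.ord, ∀ b < κ.ord, p a b < κ.ord) : IsFilterOn κ (pairProduct κ U p) := by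
  obtain ⟨hsub, huniv, hempty, hup, hinter⟩ := hU
  refine ⟨fun A hA => hA.1, ⟨subset_rfl, ?_⟩, ?_, ?_, ?_⟩
  · refine hup _ huniv _ (fun x hx => hx.1) fun a ha => ⟨ha, ?_⟩
    exact hup _ huniv _ (fun x hx => hx.1) fun b hb => ⟨hb, hp a ha b hb⟩
  · rintro ⟨-, h⟩
    simp [hempty] at h
  · intro A hA B hB hAB
    refine ⟨hB, hup _ hA.2 _ (fun x hx => hx.1) fun a ha => ⟨ha.1, ?_⟩⟩
    exact hup _ ha.2 _ (fun x hx => hx.1) fun b hb => ⟨hb.1, hAB hb.2⟩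
  · intro A hA B hB
    refine ⟨fun x hx => hA.1 hx.1, ?_⟩
    refine hup _ (hinter _ hA.2 _ hB.2) _ (fun x hx => hx.1) fun a ha => ⟨ha.1.1, ?_⟩
    exact hup _ (hinter _ ha.1.2 _ ha.2.2) _ (fun x hx => hx.1)
      fun b hb => ⟨hb.1.1, hb.1.2, hb.2.2⟩

theorem isUltraOn_pairProduct (hU : IsUltraOn κ U)
    (hp : ∀ a < κ.ord, ∀ b < κ.ord, p a b < κ.ord) : IsUltraOn κ (pairProduct κ U p) := by
  refine ⟨isFilterOn_pairProduct hU.1 hp, fun A hA => ?_⟩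
  obtain ⟨⟨-, -, -, hup, -⟩, hultra⟩ := hU
  rcases hultra {a | a < κ.ord ∧ {b | b < κ.ord ∧ p a b ∈ A} ∈ U} (fun x hx => hx.1) with h | h
  · exact Or.inl ⟨hA, h⟩
  · refine Or.inr ⟨Set.sdiff_subset, hup _ h _ (fun x hx => hx.1) fun a ha => ⟨ha.1, ?_⟩⟩
    have h' := (hultra {b | b < κ.ord ∧ p a b ∈ A} (fun x hx => hx.1)).resolve_left
      fun h' => ha.2 ⟨ha.1, h'⟩
    exact hup _ h' _ (fun x hx => hx.1)
      fun b hb => ⟨hb.1, hp a ha.1 b hb.1, fun h => hb.2 ⟨hb.1, h⟩⟩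

theorem isKappaComplete_pairProduct (hU : IsFilterOn κ U) (hc : IsKappaComplete κ U) :
    IsKappaComplete κ (pairProduct κ U p) := by
  intro S hS hne hlt
  have := hne.to_subtype
  refine ⟨fun x hx => (hS hne.some_mem).1 (hx _ hne.some_mem), ?_⟩
  refine hU.2.2.2.1 _ (hc.forall_mem hU hlt fun A : S => (hS A.2).2) _ (fun x hx => hx.1)
    fun a ha => ⟨ha.1, ?_⟩
  exact hU.2.2.2.1 _ (hc.forall_mem hU hlt fun A : S => (ha.2 A).2) _ (fun x hx => hx.1)
    fun b hb => ⟨hb.1, fun A hA => (hb.2 ⟨A, hA⟩).2⟩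

theorem containsCobounded_pairProduct (hκ : ℵ₀ ≤ κ) (hU : IsUltraOn κ U)
    (hc : IsKappaComplete κ U) (hb : ContainsCobounded κ U)
    (hp : ∀ a < κ.ord, ∀ b < κ.ord, p a b < κ.ord)
    (hinj : ∀ a < κ.ord, Set.InjOn (p a) (Set.Iio κ.ord)) :
    ContainsCobounded κ (pairProduct κ U p) := by
  intro γ hγ
  refine ⟨fun x hx => hx.2, ?_⟩
  refine hU.1.2.2.2.1 _ hU.1.2.1 _ (fun x hx => hx.1) fun a ha => ⟨ha, ?_⟩
  have hsmall : {b | b < κ.ord ∧ p a b < γ} ∉ U := by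
    intro h
    have hle := lift_le_mk_of_mem hκ hU hc hb h
    rw [← Cardinal.mk_image_eq_of_injOn _ _ ((hinj a ha).mono fun b hb => hb.1)] at hle
    have hle' := hle.trans (Cardinal.mk_le_mk_of_subset
      (show p a '' {b | b < κ.ord ∧ p a b < γ} ⊆ Set.Iio γ by
        rintro _ ⟨b, hb, rfl⟩; exact hb.2))
    rw [Cardinal.mk_Iio_ordinal, Cardinal.lift_le] at hle'
    exact absurd (Cardinal.lt_ord.1 hγ) (not_lt.2 hle')
  have h := (hU.2 {b | b < κ.ord ∧ p a b < γ} fun x hx => hx.1).resolve_left hsmall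
  exact hU.1.2.2.2.1 _ h _ (fun x hx => hx.1) fun b hb =>
    ⟨hb.1, not_lt.1 fun h => hb.2 ⟨hb.1, h⟩, hp a ha b hb.1⟩

theorem not_constantMod_pairProduct (hκ : ℵ₀ ≤ κ) (hU : IsFilterOn κ U)
    (hb : ContainsCobounded κ U) {q : Ordinal.{0} → Ordinal.{0}}
    (hq : ∀ a < κ.ord, ∀ b < κ.ord, q (p a b) = a) :
    ¬ ConstantMod κ (pairProduct κ U p) q := by
  rintro ⟨γ, hγ, -, h⟩
  refine singleton_notMem hκ hU hb γ
    (hU.2.2.2.1 _ h _ (Set.singleton_subset_iff.2 hγ) fun a ha => ?_)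
  by_contra hne
  refine hU.2.2.1 ?_
  convert ha.2
  ext b
  simp only [Set.mem_empty_iff_false, false_iff]
  rintro ⟨hb, -, hqb⟩
  exact hne ((hq a ha.1 b hb).symm.trans hqb)

theorem not_oneOneMod_pairProduct (hκ : ℵ₀ ≤ κ) (hU : IsUltraOn κ U)
    (hc : IsKappaComplete κ U) (hb : ContainsCobounded κ U) {q : Ordinal.{0} → Ordinal.{0}}
    (hq : ∀ a < κ.ord, ∀ b < κ.ord, q (p a b) = a)
    (hinj : ∀ a < κ.ord, Set.InjOn (p a) (Set.Iio κ.ord)) :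
    ¬ OneOneMod κ (pairProduct κ U p) q := by
  rintro ⟨X, ⟨-, hX⟩, hsmall⟩
  obtain ⟨a, ha, haX⟩ : {a | a < κ.ord ∧ {b | b < κ.ord ∧ p a b ∈ X} ∈ U}.Nonempty := by
    rw [Set.nonempty_iff_ne_empty]
    intro h
    exact hU.1.2.2.1 (h ▸ hX)
  have hle := lift_le_mk_of_mem hκ hU hc hb haX
  rw [← Cardinal.mk_image_eq_of_injOn _ _ ((hinj a ha).mono fun b hb => hb.1)] at hle
  refine absurd (hsmall a ha) (not_lt.2 (hle.trans (Cardinal.mk_le_mk_of_subset ?_)))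
  rintro _ ⟨b, hb, rfl⟩
  exact ⟨hb.2, hq a ha b hb.1⟩

end pairProduct

/-- every measurable cardinal `κ` carries a `κ`-complete
ultrafilter containing the co-bounded sets which is not a P-point. -/
theorem exists_non_ppoint (κ : Cardinal.{0}) (hunc : ℵ₀ < κ)
    (hmeas : ∃ U : Set (Set Ordinal.{0}),
      IsUltraOn κ U ∧ IsKappaComplete κ U ∧ ContainsCobounded κ U) :
    ∃ W : Set (Set Ordinal.{0}),
      IsUltraOn κ W ∧ IsKappaComplete κ W ∧ ContainsCobounded κ W ∧
      ∃ f : Ordinal → Ordinal, (∀ x < κ.ord, f x < κ.ord) ∧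
        ¬ ConstantMod κ W f ∧ ¬ OneOneMod κ W f := by
  obtain ⟨U, hU, hc, hb⟩ := hmeas
  have hκ := hunc.le
  obtain ⟨p, q, hp, hq, hinj, hq'⟩ := exists_pairing hκ
  exact ⟨pairProduct κ U p, isUltraOn_pairProduct hU hp, isKappaComplete_pairProduct hU.1 hc,
    containsCobounded_pairProduct hκ hU hc hb hp hinj, q, hq',
    not_constantMod_pairProduct hκ hU.1 hb hq, not_oneOneMod_pairProduct hκ hU hc hb hq hinj⟩
end
end

section
/- Let κ be a regular uncountable cardinal and let 𝒰, 𝒲 be κ-complete ultrafilters over κ. Suppose 𝒰 and 𝒲 are Rudin-Keisler equivalent, witnessed by a function f : κ → κ such that the pushforward f_*(𝒰) = {B ⊆ κ : f⁻¹(B) ∈ 𝒰} equals 𝒲 and f is injective on some set belonging to 𝒰. Then Gal(𝒰, κ, κ⁺) holds if and only if Gal(𝒲, κ, κ⁺) holds. -/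
open Cardinal Set

noncomputable section

/-- The pushforward `f₊(U) = {B ⊆ κ | f⁻¹(B) ∈ U}`. -/
def Pushforward (κ : Cardinal.{0}) (f : Ordinal → Ordinal)
    (U : Set (Set Ordinal.{0})) : Set (Set Ordinal.{0}) :=
  {B | B ⊆ Set.Iio κ.ord ∧ {x : Ordinal | x < κ.ord ∧ f x ∈ B} ∈ U}

theorem Set.nonempty_of_mk_eq_lift {κ : Cardinal.{0}} (hκ : κ ≠ 0) {I : Set Ordinal.{0}}
    (hI : Cardinal.mk ↥I = Cardinal.lift.{1, 0} κ) : I.Nonempty := by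
  rw [Set.nonempty_iff_ne_empty]
  rintro rfl
  rw [Cardinal.mk_eq_zero, eq_comm, Cardinal.lift_eq_zero] at hI
  exact hκ hI

/-- if `U` and `W` are Rudin–Keisler equivalent `κ`-complete
ultrafilters, witnessed by `f` with `f₊(U) = W` and `f` injective on a set of
`U`, then `Gal(U, κ, κ⁺)` holds iff `Gal(W, κ, κ⁺)` holds. -/
theorem rudinKeisler_equiv_Galvin (κ : Cardinal.{0}) (hreg : κ.IsRegular)
    (hunc : ℵ₀ < κ) (U W : Set (Set Ordinal.{0}))
    (hU : IsUltraOn κ U) (hUcomp : IsKappaComplete κ U)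
    (hW : IsUltraOn κ W) (hWcomp : IsKappaComplete κ W)
    (f : Ordinal → Ordinal) (hf : ∀ x < κ.ord, f x < κ.ord)
    (hpush : Pushforward κ f U = W)
    (hinj : ∃ X ∈ U, Set.InjOn f X) :
    GalvinProp U κ (Order.succ κ) ↔ GalvinProp W κ (Order.succ κ) := by
  obtain ⟨⟨hUsub, -, -, hUmono, hUinter⟩, -⟩ := hU
  obtain ⟨X, hX, hinj⟩ := hinj
  subst hpush
  have hκ : κ ≠ 0 := hreg.pos.ne'
  constructor
  · intro hGal C hC
    obtain ⟨I, hIsub, hIcard, hI⟩ :=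
      hGal (fun γ => {x | x < κ.ord ∧ f x ∈ C γ}) fun γ hγ => (hC γ hγ).2
    obtain ⟨γ₀, hγ₀⟩ := Set.nonempty_of_mk_eq_lift hκ hIcard
    refine ⟨I, hIsub, hIcard, (Set.biInter_subset_of_mem hγ₀).trans (hC γ₀ (hIsub hγ₀)).1,
      hUmono _ hI _ (fun x hx => hx.1) fun x hx => ?_⟩
    rw [Set.mem_iInter₂] at hx
    exact ⟨(hx γ₀ hγ₀).1, Set.mem_iInter₂.2 fun γ hγ => (hx γ hγ).2⟩
  · intro hGal C hC
    obtain ⟨I, hIsub, hIcard, hI⟩ := hGal (fun γ => f '' (C γ ∩ X)) fun γ hγ => by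
      refine ⟨?_, hUmono _ (hUinter _ (hC γ hγ) _ hX) _ (fun x hx => hx.1)
        fun x hx => ⟨hUsub _ hX hx.2, Set.mem_image_of_mem f hx⟩⟩
      rintro _ ⟨x, hx, rfl⟩
      exact hf x (hUsub _ hX hx.2)
    obtain ⟨γ₀, hγ₀⟩ := Set.nonempty_of_mk_eq_lift hκ hIcard
    refine ⟨I, hIsub, hIcard, hUmono _ (hUinter _ hI.2 _ hX) _
      ((Set.biInter_subset_of_mem hγ₀).trans (hUsub _ (hC γ₀ (hIsub hγ₀)))) ?_⟩
    rintro x ⟨⟨-, hx⟩, hxX⟩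
    refine Set.mem_iInter₂.2 fun γ hγ => ?_
    obtain ⟨y, hy, hyx⟩ := Set.mem_iInter₂.1 hx γ hγ
    exact hinj hy.2 hxX hyx ▸ hy.1
end
end

section
/- Let κ be an uncountable cardinal and let 𝒻 be a proper normal filter over κ (closed under diagonal intersections of κ-sequences of its members) whose dual ideal contains every subset of κ of size less than κ (equivalently, κ \ S ∈ 𝒻 for all S ⊆ κ with |S| < κ). Then for every coloring c : [κ]² → 2, either there is a set A that is 𝒻-positive (A ∩ F ≠ ∅ for every F ∈ 𝒻) with c constantly 0 on [A]², or there is B ⊆ κ of order type ω+1 with c constantly 1 on [B]². In particular κ → (κ, ω+1)² holds, since any 𝒻-positive set has cardinality κ. -/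
open Cardinal Set

noncomputable section

/-- `B` is a set of ordinals of order type `ω + 1`. -/
def OtpOmegaSucc (B : Set Ordinal.{0}) : Prop :=
  ∃ (g : ℕ → Ordinal.{0}) (t : Ordinal.{0}), StrictMono g ∧ (∀ n, g n < t) ∧
    B = Set.range g ∪ {t}

/-- `c` is constantly `i` on the pairs from `H`. -/
def Mono (c : Ordinal.{0} → Ordinal.{0} → Fin 2) (H : Set Ordinal.{0}) (i : Fin 2) : Prop :=
  ∀ α ∈ H, ∀ β ∈ H, α < β → c α β = i

/-- The partition relation `λ → (λ, ω + 1)²`. -/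
def PartitionOmegaSuccRel (lam : Cardinal.{0}) : Prop :=
  ∀ c : Ordinal.{0} → Ordinal.{0} → Fin 2,
    (∃ H : Set Ordinal.{0}, H ⊆ Set.Iio lam.ord ∧
      Cardinal.mk ↥H = Cardinal.lift.{1, 0} lam ∧ Mono c H 0) ∨
    (∃ B : Set Ordinal.{0}, B ⊆ Set.Iio lam.ord ∧ OtpOmegaSucc B ∧ Mono c B 1)

/-- `F` is normal: closed under diagonal intersections of `κ`-sequences of members. -/
def IsNormalOn (κ : Cardinal.{0}) (F : Set (Set Ordinal.{0})) : Prop :=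
  ∀ A : Ordinal → Set Ordinal.{0}, (∀ α < κ.ord, A α ∈ F) →
    {β : Ordinal | β < κ.ord ∧ ∀ α < β, β ∈ A α} ∈ F

/-- The dual ideal of `F` contains every subset of `κ` of size `< κ`. -/
def SmallSetsInDual (κ : Cardinal.{0}) (F : Set (Set Ordinal.{0})) : Prop :=
  ∀ S : Set Ordinal.{0}, S ⊆ Set.Iio κ.ord →
    Cardinal.mk ↥S < Cardinal.lift.{1, 0} κ → Set.Iio κ.ord \ S ∈ F

/-- `S` is `F`-positive: it meets every member of `F`. -/
def IsPositive (F : Set (Set Ordinal.{0})) (S : Set Ordinal.{0}) : Prop :=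
  ∀ X ∈ F, (S ∩ X).Nonempty

theorem IsPositive.inter {κ : Cardinal.{0}} {F : Set (Set Ordinal.{0})} (hfil : IsFilterOn κ F)
    {S X : Set Ordinal.{0}} (hS : IsPositive F S) (hX : X ∈ F) : IsPositive F (S ∩ X) := by
  intro Y hY
  rw [inter_assoc]
  exact hS _ (hfil.2.2.2.2 X hX Y hY)

/-- Fodor's lemma: a regressive function on an `F`-positive set, for `F` normal, is constant on an
`F`-positive subset. -/
theorem IsNormalOn.exists_positive_fiber {κ : Cardinal.{0}} {F : Set (Set Ordinal.{0})}
    (hnorm : IsNormalOn κ F) {S : Set Ordinal.{0}} (hS : IsPositive F S)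
    {f : Ordinal.{0} → Ordinal.{0}} (hf : ∀ β ∈ S, f β < β) :
    ∃ a, IsPositive F {β ∈ S | f β = a} := by
  by_contra! h
  simp only [IsPositive, not_forall, not_nonempty_iff_eq_empty] at h
  choose X hX hXe using h
  obtain ⟨β, hβS, -, hβ⟩ := hS _ (hnorm X fun α _ => hX α)
  exact (hXe (f β)).subset ⟨⟨hβS, rfl⟩, hβ _ (hf β hβS)⟩

theorem IsNormalOn.exists_positive_list_fiber_of_length {κ : Cardinal.{0}}
    {F : Set (Set Ordinal.{0})} (hnorm : IsNormalOn κ F) (n : ℕ) {S : Set Ordinal.{0}}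
    (hS : IsPositive F S) {p : Ordinal.{0} → List Ordinal.{0}}
    (hp : ∀ β ∈ S, ∀ a ∈ p β, a < β) (hn : ∀ β ∈ S, (p β).length = n) :
    ∃ l, IsPositive F {β ∈ S | p β = l} := by
  induction n generalizing S p with
  | zero =>
    refine ⟨[], ?_⟩
    convert hS using 1
    ext β
    exact ⟨fun h => h.1, fun h => ⟨h, List.length_eq_zero_iff.1 (hn β h)⟩⟩
  | succ n ih =>
    have hcons : ∀ β ∈ S, p β = (p β).headD 0 :: (p β).tail := by
      intro β hβ
      have := hn β hβ
      cases h : p β <;> simp_all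
    obtain ⟨a, ha⟩ := hnorm.exists_positive_fiber hS (f := fun β => (p β).headD 0)
      (fun β hβ => hp β hβ _ (by rw [hcons β hβ]; simp))
    obtain ⟨l, hl⟩ := ih ha (p := fun β => (p β).tail)
      (fun β hβ b hb => hp β hβ.1 b (List.mem_of_mem_tail hb))
      (fun β hβ => by simp [hn β hβ.1])
    refine ⟨a :: l, fun X hX => (hl X hX).mono ?_⟩
    rintro β ⟨⟨⟨hβ, h1⟩, h2⟩, h3⟩
    refine ⟨⟨hβ, ?_⟩, h3⟩
    rw [hcons β hβ]
    exact congrArg₂ _ h1 h2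

/-- Fodor's lemma for functions assigning to each `β` a finite sequence of ordinals below `β`. -/
theorem IsNormalOn.exists_positive_list_fiber {κ : Cardinal.{0}} (hunc : ℵ₀ < κ)
    {F : Set (Set Ordinal.{0})} (hfil : IsFilterOn κ F) (hnorm : IsNormalOn κ F)
    (hsmall : SmallSetsInDual κ F) {S : Set Ordinal.{0}}
    (hS : IsPositive F S) {p : Ordinal.{0} → List Ordinal.{0}}
    (hp : ∀ β ∈ S, ∀ a ∈ p β, a < β) :
    ∃ l, IsPositive F {β ∈ S | p β = l} := by
  have hω : Iio κ.ord \ Iio Ordinal.omega0 ∈ F := by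
    refine hsmall _ (Iio_subset_Iio ?_) ?_
    · rw [← ord_aleph0]
      exact ord_le_ord.2 hunc.le
    · rw [mk_Iio_ordinal, Ordinal.card_omega0]
      exact lift_lt.2 hunc
  obtain ⟨a, ha⟩ := hnorm.exists_positive_fiber (hS.inter hfil hω)
    (f := fun β => ((p β).length : Ordinal))
    (fun β hβ => (Ordinal.natCast_lt_omega0 _).trans_le (not_lt.1 hβ.2.2))
  obtain ⟨β₀, ⟨-, h₀⟩, -⟩ := ha _ hω
  obtain ⟨l, hl⟩ := hnorm.exists_positive_list_fiber_of_length (p β₀).length ha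
    (fun β hβ => hp β hβ.1.1) (fun β hβ => by exact_mod_cast hβ.2.trans h₀.symm)
  refine ⟨l, fun X hX => (hl X hX).mono ?_⟩
  rintro β ⟨⟨⟨⟨hβ, -⟩, -⟩, h2⟩, h3⟩
  exact ⟨⟨hβ, h2⟩, h3⟩

/-- `p` is a decreasing list of ordinals below `β` which together with `β` is
`1`-monochromatic. -/
def IsOneChain (c : Ordinal.{0} → Ordinal.{0} → Fin 2) (β : Ordinal.{0})
    (p : List Ordinal.{0}) : Prop :=
  (β :: p).Pairwise fun a b => b < a ∧ c b a = 1

theorem exists_otpOmegaSucc_of_extendable {c : Ordinal.{0} → Ordinal.{0} → Fin 2}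
    {β : Ordinal.{0}} (h : ∀ p, IsOneChain c β p → ∃ a, IsOneChain c β (a :: p)) :
    ∃ B ⊆ Iic β, OtpOmegaSucc B ∧ Mono c B 1 := by
  choose! next hnext using h
  let s : ℕ → List Ordinal.{0} := fun n => Nat.rec [] (fun _ p => next p :: p) n
  have hs : ∀ n, IsOneChain c β (s n) := by
    intro n
    induction n with
    | zero => exact List.pairwise_singleton _ _
    | succ n ih => exact hnext _ ih
  let g : ℕ → Ordinal.{0} := fun n => next (s n)
  have hmem : ∀ {m n}, m < n → g m ∈ s n := by
    intro m n hmn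
    induction n, hmn using Nat.le_induction with
    | base => exact List.mem_cons_self
    | succ n _ ih => exact List.mem_cons_of_mem _ ih
  have hlt : ∀ {m n}, m < n → g m < g n ∧ c (g m) (g n) = 1 := fun {m n} hmn =>
    (List.pairwise_cons.1 (List.pairwise_cons.1 (hs (n + 1))).2).1 _ (hmem hmn)
  have hβ : ∀ n, g n < β ∧ c (g n) β = 1 := fun n =>
    (List.pairwise_cons.1 (hs (n + 1))).1 _ (hmem n.lt_succ_self)
  have hg : StrictMono g := fun m n hmn => (hlt hmn).1
  refine ⟨range g ∪ {β}, ?_, ⟨g, β, hg, fun n => (hβ n).1, rfl⟩, ?_⟩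
  · rintro x (⟨n, rfl⟩ | rfl)
    exacts [(hβ n).1.le, self_mem_Iic]
  · rintro x (⟨m, rfl⟩ | rfl) y (⟨n, rfl⟩ | rfl) hxy
    · exact (hlt (hg.lt_iff_lt.1 hxy)).2
    · exact (hβ m).2
    · exact absurd hxy (hβ n).1.not_gt
    · exact absurd hxy (lt_irrefl _)

theorem exists_positive_mono_or_otpOmegaSucc {κ : Cardinal.{0}} (hunc : ℵ₀ < κ)
    {F : Set (Set Ordinal.{0})} (hfil : IsFilterOn κ F) (hnorm : IsNormalOn κ F)
    (hsmall : SmallSetsInDual κ F) (c : Ordinal.{0} → Ordinal.{0} → Fin 2) :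
    (∃ A ⊆ Iio κ.ord, IsPositive F A ∧ Mono c A 0) ∨
      ∃ B ⊆ Iio κ.ord, OtpOmegaSucc B ∧ Mono c B 1 := by
  refine or_iff_not_imp_right.2 fun hB => ?_
  have hmax : ∀ β < κ.ord, ∃ p, IsOneChain c β p ∧ ∀ a, ¬ IsOneChain c β (a :: p) := by
    intro β hβ
    by_contra! h
    obtain ⟨B, hBβ, hB'⟩ := exists_otpOmegaSucc_of_extendable h
    exact hB ⟨B, fun x hx => (hBβ hx).trans_lt hβ, hB'⟩
  choose! p hp hpmax using hmax
  have hpos : IsPositive F (Iio κ.ord) := by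
    intro X hX
    rw [inter_eq_right.2 (hfil.1 X hX), nonempty_iff_ne_empty]
    rintro rfl
    exact hfil.2.2.1 hX
  obtain ⟨l, hl⟩ := hnorm.exists_positive_list_fiber hunc hfil hsmall hpos (p := p)
    (fun β hβ a ha => ((List.pairwise_cons.1 (hp β hβ)).1 a ha).1)
  refine ⟨_, fun β (hβ : β ∈ {β ∈ Iio κ.ord | p β = l}) => hβ.1, hl, ?_⟩
  rintro α ⟨hα, rfl⟩ β ⟨hβ, hpβ⟩ hlt
  by_contra hc
  have hc1 : c α β = 1 := Fin.eq_one_of_ne_zero _ hc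
  refine hpmax β hβ α (List.pairwise_cons.2 ⟨?_, hpβ ▸ hp α hα⟩)
  rintro b (_ | ⟨_, hb⟩)
  · exact ⟨hlt, hc1⟩
  · exact (List.pairwise_cons.1 (hp β hβ)).1 b hb

theorem IsPositive.mk_eq {κ : Cardinal.{0}} {F : Set (Set Ordinal.{0})}
    (hsmall : SmallSetsInDual κ F) {A : Set Ordinal.{0}} (hA : A ⊆ Iio κ.ord)
    (hpos : IsPositive F A) : Cardinal.mk ↥A = Cardinal.lift.{1, 0} κ := by
  refine le_antisymm ((mk_le_mk_of_subset hA).trans_eq ?_) (not_lt.1 fun h => ?_)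
  · rw [mk_Iio_ordinal, card_ord]
  · obtain ⟨x, hxA, -, hx⟩ := hpos _ (hsmall A hA h)
    exact hx hxA

/-- if `F` is a proper normal filter on the uncountable cardinal
`κ` whose dual ideal contains all sets of size `< κ`, then every `2`-coloring
of pairs from `κ` admits either an `F`-positive `0`-monochromatic set or a
`1`-monochromatic set of order type `ω + 1`; in particular `κ → (κ, ω+1)²`. -/
theorem normal_filter_positive_partition (κ : Cardinal.{0}) (hunc : ℵ₀ < κ)
    (F : Set (Set Ordinal.{0})) (hfil : IsFilterOn κ F) (hnorm : IsNormalOn κ F)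
    (hsmall : SmallSetsInDual κ F) :
    (∀ c : Ordinal.{0} → Ordinal.{0} → Fin 2,
      (∃ A : Set Ordinal.{0}, A ⊆ Set.Iio κ.ord ∧
        (∀ X ∈ F, (A ∩ X).Nonempty) ∧ Mono c A 0) ∨
      (∃ B : Set Ordinal.{0}, B ⊆ Set.Iio κ.ord ∧ OtpOmegaSucc B ∧ Mono c B 1)) ∧
    PartitionOmegaSuccRel κ := by
  have key := exists_positive_mono_or_otpOmegaSucc hunc hfil hnorm hsmall
  refine ⟨key, fun c => (key c).imp_left ?_⟩
  rintro ⟨A, hA, hpos, hmono⟩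
  exact ⟨A, hA, hpos.mk_eq hsmall hA, hmono⟩
end
end

section
/- Suppose ℵ₀ < κ = cf(λ) < λ, and κ carries a normal κ-complete ultrafilter 𝒰 (containing every co-bounded subset of κ and closed under diagonal intersections). Suppose ⟨λ_i : i < κ⟩ is a strictly increasing sequence of regular cardinals cofinal in λ with λ_0 > κ, such that for every i < κ: (a) there is a proper normal filter 𝒰_i over λ_i whose dual ideal contains every subset of λ_i of size less than λ_i, and (b) Gal(𝒰, λ_i, λ_i) holds, i.e. every family of λ_i many members of 𝒰 admits a subfamily of λ_i many indices whose intersection belongs to 𝒰. Then λ → (λ, ω+1)². -/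
open Cardinal Set

noncomputable section

section

open Filter

/-- `f` is a proper normal filter concentrating on the final segments of the cardinal `κ`. -/
structure IsNormalAt (κ : Cardinal.{0}) (f : Filter Ordinal.{0}) : Prop where
  neBot : f.NeBot
  lt : ∀ᶠ β in f, β < κ.ord
  ge : ∀ γ < κ.ord, ∀ᶠ β in f, γ ≤ β
  diag : ∀ P : Ordinal.{0} → Ordinal.{0} → Prop, (∀ α < κ.ord, ∀ᶠ β in f, P α β) →
    ∀ᶠ β in f, ∀ α < β, P α β

/-- The Mathlib filter generated by a filter on `κ`. -/
def IsFilterOn.toFilter {κ : Cardinal.{0}} {F : Set (Set Ordinal.{0})} (hF : IsFilterOn κ F) :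
    Filter Ordinal.{0} where
  sets := {A | A ∩ Set.Iio κ.ord ∈ F}
  univ_sets := by simpa using hF.2.1
  sets_of_superset {A B} hA hAB :=
    hF.2.2.2.1 _ hA _ inter_subset_right (inter_subset_inter_left _ hAB)
  inter_sets {A B} hA hB := by
    have := hF.2.2.2.2 _ hA _ hB
    rwa [← inter_inter_distrib_right] at this

theorem IsFilterOn.mem_toFilter {κ : Cardinal.{0}} {F : Set (Set Ordinal.{0})}
    (hF : IsFilterOn κ F) {A : Set Ordinal.{0}} :
    A ∈ hF.toFilter ↔ A ∩ Set.Iio κ.ord ∈ F := Iff.rfl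

theorem IsFilterOn.mem_toFilter_of_mem {κ : Cardinal.{0}} {F : Set (Set Ordinal.{0})}
    (hF : IsFilterOn κ F) {A : Set Ordinal.{0}} (hA : A ∈ F) : A ∈ hF.toFilter := by
  rw [hF.mem_toFilter, inter_eq_left.2 (hF.1 A hA)]
  exact hA

theorem IsFilterOn.isNormalAt {κ : Cardinal.{0}} {F : Set (Set Ordinal.{0})}
    (hF : IsFilterOn κ F) (hN : IsNormalOn κ F) (hcb : ContainsCobounded κ F) :
    IsNormalAt κ hF.toFilter where
  neBot := by
    rw [neBot_iff, ne_eq, ← empty_mem_iff_bot, hF.mem_toFilter, empty_inter]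
    exact hF.2.2.1
  lt := hF.mem_toFilter_of_mem hF.2.1
  ge γ hγ := by
    filter_upwards [hF.mem_toFilter_of_mem (hcb γ hγ)] with β hβ using hβ.1
  diag P hP := by
    filter_upwards [hF.mem_toFilter_of_mem (hN (fun α => {β | P α β} ∩ Set.Iio κ.ord) hP)]
      with β hβ α hα using (hβ.2 α hα).1

theorem mk_Iio_lt_of_lt_ord {κ : Cardinal.{0}} {γ : Ordinal.{0}} (hγ : γ < κ.ord) :
    #(Set.Iio γ) < Cardinal.lift.{1, 0} κ := by
  rw [Cardinal.mk_Iio_ordinal, Cardinal.lift_lt]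
  exact lt_ord.1 hγ

theorem SmallSetsInDual.containsCobounded {κ : Cardinal.{0}} {F : Set (Set Ordinal.{0})}
    (hs : SmallSetsInDual κ F) : ContainsCobounded κ F := by
  intro γ hγ
  have := hs (Set.Iio γ) (fun x hx => lt_trans hx hγ) (mk_Iio_lt_of_lt_ord hγ)
  convert this using 1
  ext x
  simp

namespace IsNormalAt

variable {κ : Cardinal.{0}} {f : Filter Ordinal.{0}}

theorem eventually_forall_lt (h : IsNormalAt κ f) {δ : Ordinal.{0}} (hδ : δ < κ.ord)
    {P : Ordinal.{0} → Ordinal.{0} → Prop} (hP : ∀ α < δ, ∀ᶠ β in f, P α β) :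
    ∀ᶠ β in f, ∀ α < δ, P α β := by
  have := h.diag (fun α β => α < δ → P α β) fun α _ => by
    by_cases hα : α < δ
    · simpa [hα] using hP α hα
    · simp [hα]
  filter_upwards [this, h.ge δ hδ] with β hβ hδβ α hα using hβ α (hα.trans_le hδβ) hα

theorem eventually_forall (h : IsNormalAt κ f) {ι : Type 1} (hι : #ι < Cardinal.lift.{1, 0} κ)
    {P : ι → Ordinal.{0} → Prop} (hP : ∀ i, ∀ᶠ β in f, P i β) :
    ∀ᶠ β in f, ∀ i, P i β := by
  obtain ⟨μ, hμκ, hμ⟩ := lt_lift_iff.1 hι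
  have : #ι = #(Set.Iio μ.ord) := by rw [Cardinal.mk_Iio_ordinal, card_ord, hμ]
  obtain ⟨e⟩ := Cardinal.eq.1 this
  have := h.eventually_forall_lt (ord_lt_ord.2 hμκ)
    (P := fun α β => ∀ hα : α < μ.ord, P (e.symm ⟨α, hα⟩) β) fun α hα => by
      simpa only [hα, forall_true_left] using hP (e.symm ⟨α, hα⟩)
  filter_upwards [this] with β hβ i
  simpa using hβ (e i) (e i).2 (e i).2

theorem exists_frequently_eq (h : IsNormalAt κ f) {δ : Ordinal.{0}} (hδ : δ < κ.ord)
    {P : Ordinal.{0} → Prop} (hP : ∃ᶠ β in f, P β) (r : Ordinal.{0} → Ordinal.{0})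
    (hr : ∀ β, P β → r β < δ) : ∃ γ < δ, ∃ᶠ β in f, P β ∧ r β = γ := by
  by_contra! H
  have H' := h.eventually_forall_lt hδ (P := fun γ β => ¬ (P β ∧ r β = γ)) fun γ hγ =>
    by simpa using H γ hγ
  obtain ⟨β, hβ, hβ'⟩ := (hP.and_eventually H').exists
  exact hβ' _ (hr β hβ) ⟨hβ, rfl⟩

theorem le_mk_of_frequently (h : IsNormalAt κ f) {S : Set Ordinal.{0}}
    (hS : ∃ᶠ β in f, β ∈ S) (hκ : Order.IsSuccPrelimit κ.ord) : Cardinal.lift.{1, 0} κ ≤ #S := by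
  by_contra! H
  have := h.eventually_forall H (P := fun (x : S) β => x.1 ≠ β) fun x => by
    by_cases hx : x.1 < κ.ord
    · filter_upwards [h.ge _ (hκ.succ_lt hx)] with β hβ
      exact (Order.succ_le_iff.1 hβ).ne
    · filter_upwards [h.lt] with β hβ e
      exact hx (e ▸ hβ)
  obtain ⟨β, hβ, hβ'⟩ := (hS.and_eventually this).exists
  exact hβ' ⟨β, hβ⟩ rfl

end IsNormalAt

/-- `s'` arises from `s` by adding, on top of `s`, a point below `μ` and `β` joined by `c` in
colour `1` to `β` and to all of `s`. -/
def EndExtends (c : Ordinal.{0} → Ordinal.{0} → Fin 2) (β μ : Ordinal.{0})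
    (s' s : Finset Ordinal.{0}) : Prop :=
  ∃ α, α < μ ∧ α < β ∧ c α β = 1 ∧ (∀ x ∈ s, x < α ∧ c x α = 1) ∧ s' = insert α s

theorem wellFounded_endExtends {c : Ordinal.{0} → Ordinal.{0} → Fin 2} {β : Ordinal.{0}}
    (hβ : ∀ B ⊆ Set.Iic β, OtpOmegaSucc B → ¬ Mono c B 1) (μ : Ordinal.{0}) :
    WellFounded (EndExtends c β μ) := by
  rw [wellFounded_iff_isEmpty_descending_chain]
  refine ⟨fun ⟨s, hs⟩ => ?_⟩
  choose g _ hgβ hgc hgs hsg using hs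
  have hmem : ∀ m n, m < n → g m ∈ s n := by
    intro m n hmn
    induction n, hmn using Nat.le_induction with
    | base => rw [hsg]; exact Finset.mem_insert_self _ _
    | succ n _ ih => rw [hsg]; exact Finset.mem_insert_of_mem ih
  have hmono : StrictMono g := fun m n hmn => (hgs n _ (hmem m n hmn)).1
  refine hβ (Set.range g ∪ {β}) ?_ ⟨g, β, hmono, hgβ, rfl⟩ ?_
  · rintro x (⟨n, rfl⟩ | hx)
    · exact (hgβ n).le
    · exact le_of_eq hx
  · rintro x (⟨m, rfl⟩ | rfl) y (⟨n, rfl⟩ | rfl) hxy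
    · exact (hgs n _ (hmem m n (hmono.lt_iff_lt.1 hxy))).2
    · exact hgc m
    · exact absurd hxy (hgβ n).not_gt
    · exact absurd hxy (lt_irrefl _)

theorem exists_rank_lt {α : Type 1} {r : α → α → Prop} (hr : WellFounded r) {θ : Cardinal.{0}}
    (hθ : θ.IsRegular) (hfib : ∀ a, #{b // r b a} < Cardinal.lift.{1, 0} θ) :
    ∃ ρ : α → Ordinal.{0}, (∀ a, ρ a < θ.ord) ∧ ∀ a b, r a b → ρ a < ρ b := by
  have : IsWellFounded α r := ⟨hr⟩
  have hlt : ∀ a, IsWellFounded.rank r a < Ordinal.lift.{1, 0} θ.ord := by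
    intro a
    induction a using hr.induction with
    | _ a ih =>
      rw [IsWellFounded.rank_eq, lift_ord]
      rw [lift_ord] at ih
      refine Ordinal.iSup_lt_of_lt_cof ?_ fun b => ?_
      · rw [hθ.lift.cof_ord]
        exact hfib a
      · exact (isSuccLimit_ord hθ.lift.aleph0_le).succ_lt (ih b.1 b.2)
  choose ρ hρθ hρ using fun a => Ordinal.lt_lift_iff.1 (hlt a)
  refine ⟨ρ, hρθ, fun a b hab => ?_⟩
  rw [← Ordinal.lift_lt.{1, 0}, hρ, hρ]
  exact IsWellFounded.rank_lt_of_rel hab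

theorem exists_endExtends_rank {c : Ordinal.{0} → Ordinal.{0} → Fin 2} {β : Ordinal.{0}}
    (hβ : ∀ B ⊆ Set.Iic β, OtpOmegaSucc B → ¬ Mono c B 1) {θ : Cardinal.{0}}
    (hθ : θ.IsRegular) {μ : Ordinal.{0}} (hμ : μ < θ.ord) :
    ∃ ρ : Finset Ordinal.{0} → Ordinal.{0}, (∀ s, ρ s < θ.ord) ∧
      ∀ s' s, EndExtends c β μ s' s → ρ s' < ρ s := by
  refine exists_rank_lt (wellFounded_endExtends hβ μ) hθ fun s => ?_
  refine lt_of_le_of_lt ?_ (mk_Iio_lt_of_lt_ord hμ)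
  refine (mk_le_mk_of_subset (t := (fun α => insert α s) '' Set.Iio μ) ?_).trans mk_image_le
  rintro _ ⟨α, hα, _, _, _, rfl⟩
  exact ⟨α, hα, rfl⟩

theorem mk_finset_lt {α : Type 1} {κ : Cardinal.{1}} (hκ : ℵ₀ < κ) (hα : #α < κ) :
    #(Finset α) < κ := by
  cases finite_or_infinite α
  · exact (lt_aleph0_of_finite _).trans hκ
  · rwa [mk_finset_of_infinite]

/-- A positive set for a normal filter contains a positive `0`-homogeneous set unless `c` has a
`1`-homogeneous set of type `ω + 1`. -/
theorem IsNormalAt.exists_mono_zero {κ : Cardinal.{0}} {f : Filter Ordinal.{0}}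
    (h : IsNormalAt κ f) (hκ : ℵ₀ < κ) {c : Ordinal.{0} → Ordinal.{0} → Fin 2}
    (hc : ∀ B ⊆ Set.Iio κ.ord, OtpOmegaSucc B → ¬ Mono c B 1)
    {S : Set Ordinal.{0}} (hS : ∃ᶠ β in f, β ∈ S) :
    ∃ T ⊆ S, (∃ᶠ β in f, β ∈ T) ∧ Mono c T 0 := by
  have hlim := isSuccLimit_ord hκ.le
  let M : Finset Ordinal.{0} → Set Ordinal.{0} := fun s =>
    {β ∈ S | (∀ x ∈ s, x < β ∧ c x β = 1) ∧ ∀ s', ¬ EndExtends c β β s' s}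
  by_cases hM : ∃ s, ∃ᶠ β in f, β ∈ M s
  · obtain ⟨s, hs⟩ := hM
    refine ⟨M s, fun β hβ => hβ.1, hs, fun α hα β hβ hαβ => ?_⟩
    by_contra hne
    exact hβ.2.2 (insert α s) ⟨α, hαβ, hαβ, by omega, hα.2.1, rfl⟩
  · exfalso
    push Not at hM
    have key := h.diag (fun α β => ∀ s : Finset (Set.Iic α), β ∉ M (s.map (.subtype _)))
      fun α hα => h.eventually_forall (mk_finset_lt (by simpa using hκ) (by
        rw [← Order.Iio_succ]
        exact mk_Iio_lt_of_lt_ord (hlim.succ_lt hα))) fun s => hM _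
    obtain ⟨β, hβS, hβ, hβ1, hβκ⟩ :=
      (hS.and_eventually (key.and ((h.ge 1 (Ordinal.one_lt_omega0.trans (by simpa using ord_lt_ord.2 hκ))).and h.lt))).exists
    have hwf := wellFounded_endExtends (c := c) (β := β)
      (fun B hB => hc B (hB.trans fun x hx => lt_of_le_of_lt hx hβκ)) β
    obtain ⟨s, hs, hmin⟩ := hwf.has_min {s | ∀ x ∈ s, x < β ∧ c x β = 1} ⟨∅, by simp⟩
    have hsM : β ∈ M s := by
      refine ⟨hβS, hs, fun s' hs' => hmin s' ?_ hs'⟩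
      obtain ⟨α, _, hα, hαc, _, rfl⟩ := hs'
      intro x hx
      rcases Finset.mem_insert.1 hx with rfl | hx
      · exact ⟨hα, hαc⟩
      · exact hs x hx
    obtain ⟨α, hα, hsα⟩ : ∃ α < β, ∀ x ∈ s, x ≤ α := by
      rcases s.eq_empty_or_nonempty with rfl | hne
      · exact ⟨0, by simpa [Order.one_le_iff_pos] using hβ1, by simp⟩
      · exact ⟨s.max' hne, (hs _ (s.max'_mem hne)).1, fun x hx => s.le_max' x hx⟩
    refine hβ α hα (s.subtype (· ∈ Set.Iic α)) ?_
    rwa [Finset.subtype_map_of_mem (p := (· ∈ Set.Iic α)) hsα]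

/-- Without `1`-homogeneous sets of type `ω + 1`, some sequence of positive sets consists of points
that are not joined in colour `1` to positively many points of `U`-almost all its terms. -/
theorem exists_positive_system {κ lam : Cardinal.{0}} (hκ : ℵ₀ < κ) {U : Filter Ordinal.{0}}
    (hU : IsNormalAt κ U) {l : Ordinal.{0} → Cardinal.{0}} (hlreg : ∀ i < κ.ord, (l i).IsRegular)
    (hlmono : ∀ i j : Ordinal, i < j → j < κ.ord → l i < l j)
    (hlub : ∀ i < κ.ord, l i < lam) {V : Ordinal.{0} → Filter Ordinal.{0}}
    (hV : ∀ j < κ.ord, IsNormalAt (l (j + 2)) (V j))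
    {c : Ordinal.{0} → Ordinal.{0} → Fin 2}
    (hc : ∀ B ⊆ Set.Iio lam.ord, OtpOmegaSucc B → ¬ Mono c B 1) :
    ∃ S : Ordinal.{0} → Set Ordinal.{0}, (∀ᶠ j in U, ∃ᶠ β in V j, β ∈ S j) ∧
      ∀ i, ∀ α ∈ S i, ¬ ∀ᶠ j in U, ∃ᶠ β in V j, β ∈ S j ∧ c α β = 1 := by
  by_contra! hbad
  have := hU.neBot
  have hκlim := isSuccLimit_ord hκ.le
  have h1 : ∀ {j}, j < κ.ord → j + 1 < κ.ord := fun hj => hκlim.add_one_lt hj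
  have h2 : ∀ {j}, j < κ.ord → j + 2 < κ.ord := fun {j} hj => by
    rw [← one_add_one_eq_two, ← add_assoc]
    exact h1 (h1 hj)
  have hlt12 : ∀ {j}, j < κ.ord → l (j + 1) < l (j + 2) := fun {j} hj =>
    hlmono _ _ (by simp) (h2 hj)
  have hlt01 : ∀ {j}, j < κ.ord → l j < l (j + 1) := fun {j} hj =>
    hlmono _ _ (by simp) (h1 hj)
  have hρ : ∀ j β, ∃ ρ : Finset Ordinal.{0} → Ordinal.{0}, j < κ.ord → β < (l (j + 2)).ord →
      (∀ s, ρ s < (l (j + 1)).ord) ∧ ∀ s' s, EndExtends c β (l j).ord s' s → ρ s' < ρ s := by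
    intro j β
    by_cases h : j < κ.ord ∧ β < (l (j + 2)).ord
    · have hβ : β < lam.ord := h.2.trans (ord_lt_ord.2 (hlub _ (h2 h.1)))
      obtain ⟨ρ, hρ⟩ := exists_endExtends_rank (c := c) (β := β)
        (fun B hB => hc B (hB.trans fun x hx => lt_of_le_of_lt hx hβ)) (hlreg _ (h1 h.1))
        (ord_lt_ord.2 (hlt01 h.1))
      exact ⟨ρ, fun _ _ => hρ⟩
    · exact ⟨fun _ => 0, fun hj hβ => absurd ⟨hj, hβ⟩ h⟩
  choose ρ hρ using hρ
  let Inv : Finset Ordinal.{0} × (Ordinal.{0} → Set Ordinal.{0}) × (Ordinal.{0} → Ordinal.{0}) →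
      Prop := fun x => (∀ᶠ j in U, ∃ᶠ β in V j, β ∈ x.2.1 j) ∧
    (∀ᶠ j in U, x.2.2 j < (l (j + 2)).ord) ∧
    ∀ j, ∀ β ∈ x.2.1 j, (∀ y ∈ x.1, y < β ∧ c y β = 1) ∧ ρ j β x.1 = x.2.2 j ∧
      j < κ.ord ∧ β < (l (j + 2)).ord
  have hinit : ∃ x, Inv x := by
    have : ∀ᶠ j in U, ∃ γ, γ < (l (j + 2)).ord ∧
        ∃ᶠ β in V j, (j < κ.ord ∧ β < (l (j + 2)).ord) ∧ ρ j β ∅ = γ := by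
      filter_upwards [hU.lt] with j hj
      have := (hV j hj).neBot
      obtain ⟨γ, hγ, hγ'⟩ := (hV j hj).exists_frequently_eq (ord_lt_ord.2 (hlt12 hj))
        (P := fun β => j < κ.ord ∧ β < (l (j + 2)).ord)
        ((hV j hj).lt.mono fun β hβ => ⟨hj, hβ⟩).frequently (fun β => ρ j β ∅)
        (fun β hβ => (hρ j β hβ.1 hβ.2).1 ∅)
      exact ⟨γ, hγ.trans (ord_lt_ord.2 (hlt12 hj)), hγ'⟩
    obtain ⟨γ, hγ⟩ := this.choice
    refine ⟨⟨∅, fun j => {β | (j < κ.ord ∧ β < (l (j + 2)).ord) ∧ ρ j β ∅ = γ j}, γ⟩,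
      hγ.mono fun j hj => hj.2, hγ.mono fun j hj => hj.1, fun j β hβ => ?_⟩
    exact ⟨by simp, hβ.2, hβ.1⟩
  have hstep : ∀ x : {x // Inv x}, ∃ y : {x // Inv x}, ∀ᶠ j in U, y.1.2.2 j < x.1.2.2 j := by
    rintro ⟨⟨s, S, γ⟩, hS, hγ, hinv⟩
    obtain ⟨i, α, hα, hα'⟩ := hbad S hS
    obtain ⟨hsα, -, hi, hαi⟩ := hinv i α hα
    dsimp only at hS hγ hinv hsα
    have hstep' : ∀ j, i + 2 ≤ j → j < κ.ord → α < (l j).ord := fun j hij hj => by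
      refine hαi.trans_le (ord_le_ord.2 ?_)
      rcases hij.eq_or_lt with rfl | h
      · exact le_rfl
      · exact (hlmono _ _ h hj).le
    have hrank : ∀ j, i + 2 ≤ j → ∀ β ∈ S j, c α β = 1 → α < β →
        ρ j β (insert α s) < γ j := by
      intro j hij β hβ hcβ hαβ
      obtain ⟨hsβ, hργ, hj, hβl⟩ := hinv j β hβ
      rw [← hργ]
      exact (hρ j β hj hβl).2 _ _ ⟨α, hstep' j hij hj, hαβ, hcβ, hsα, rfl⟩
    have : ∀ᶠ j in U, ∃ γ', γ' < γ j ∧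
        ∃ᶠ β in V j, (β ∈ S j ∧ c α β = 1 ∧ α < β) ∧ ρ j β (insert α s) = γ' := by
      filter_upwards [hU.ge _ (h2 hi), hU.lt, hα', hγ] with j hij hj hfreq hγj
      refine (hV j hj).exists_frequently_eq hγj ?_ _ fun β hβ => hrank j hij β hβ.1 hβ.2.1 hβ.2.2
      refine (hfreq.and_eventually ((hV j hj).ge (l j).ord
        (ord_lt_ord.2 ((hlt01 hj).trans (hlt12 hj))))).mono fun β hβ => ?_
      exact ⟨hβ.1.1, hβ.1.2, (hstep' j hij hj).trans_le hβ.2⟩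
    obtain ⟨γ', hγ'⟩ := this.choice
    refine ⟨⟨⟨insert α s, fun j => {β | (β ∈ S j ∧ c α β = 1 ∧ α < β) ∧
      ρ j β (insert α s) = γ' j}, γ'⟩, hγ'.mono fun j hj => hj.2, ?_, ?_⟩,
      hγ'.mono fun j hj => hj.1⟩
    · filter_upwards [hγ, hγ'] with j h h' using h'.1.trans h
    · intro j β hβ
      obtain ⟨hsβ, -, hj, hβl⟩ := hinv j β hβ.1.1
      refine ⟨fun y hy => ?_, hβ.2, hj, hβl⟩
      rcases Finset.mem_insert.1 hy with rfl | hy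
      · exact ⟨hβ.1.2.2, hβ.1.2.1⟩
      · exact hsβ y hy
  obtain ⟨x₀, hx₀⟩ := hinit
  choose next hnext using hstep
  let x : ℕ → {x // Inv x} := fun n => next^[n] ⟨x₀, hx₀⟩
  have hx : ∀ n, ∀ᶠ j in U, (x (n + 1)).1.2.2 j < (x n).1.2.2 j := fun n => by
    simp only [x, Function.iterate_succ_apply']
    exact hnext _
  have hall := hU.eventually_forall (ι := ULift.{1} ℕ) (by simpa using hκ) fun n => hx n.down
  obtain ⟨j, hj⟩ := hall.exists
  exact (wellFounded_iff_isEmpty_descending_chain.1 (wellFounded_lt (α := Ordinal.{0}))).false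
    ⟨fun n => (x n).1.2.2 j, fun n => hj ⟨n⟩⟩

/-- The step at a single cardinal: a positive set contains a `0`-homogeneous set of full size which
is joined in colour `0` to all points of `A` and whose points simultaneously satisfy `W`
on a large set. -/
theorem IsNormalAt.exists_mono_zero_of_galvin {μ : Cardinal.{0}} {f U : Filter Ordinal.{0}}
    (h : IsNormalAt μ f) (hμ : ℵ₀ < μ) {c : Ordinal.{0} → Ordinal.{0} → Fin 2}
    (hc : ∀ B ⊆ Set.Iio μ.ord, OtpOmegaSucc B → ¬ Mono c B 1)
    (hgal : ∀ C : Ordinal.{0} → Set Ordinal.{0}, (∀ γ < μ.ord, C γ ∈ U) →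
      ∃ I ⊆ Set.Iio μ.ord, #I = Cardinal.lift.{1, 0} μ ∧ (⋂ γ ∈ I, C γ) ∈ U)
    {S : Set Ordinal.{0}} (hS : ∃ᶠ β in f, β ∈ S) {W : Ordinal.{0} → Set Ordinal.{0}}
    (hW : ∀ α ∈ S, W α ∈ U) {ν : Ordinal.{0}} (hν : ν < μ.ord) {A : Set Ordinal.{0}}
    (hA : ∀ α < ν, α ∈ A → ∀ᶠ β in f, β ∈ S → c α β = 0) :
    ∃ H ⊆ S, (∀ β ∈ H, ν ≤ β ∧ β < μ.ord) ∧ #H = Cardinal.lift.{1, 0} μ ∧ Mono c H 0 ∧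
      (∀ α < ν, α ∈ A → ∀ β ∈ H, c α β = 0) ∧ ∀ᶠ k in U, ∀ α ∈ H, k ∈ W α := by
  have hA' := h.eventually_forall_lt hν (P := fun α β => α ∈ A → β ∈ S → c α β = 0)
    fun α hα => by
      by_cases hαA : α ∈ A
      · simpa [hαA] using hA α hα hαA
      · simp [hαA]
  obtain ⟨T, hTS, hT, hTc⟩ := h.exists_mono_zero hμ hc
    (S := {β ∈ S | (ν ≤ β ∧ β < μ.ord) ∧ ∀ α < ν, α ∈ A → c α β = 0})
    ((hS.and_eventually (hA'.and ((h.ge ν hν).and h.lt))).mono fun β hβ =>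
      ⟨hβ.1, hβ.2.2, fun α hα hαA => hβ.2.1 α hα hαA hβ.1⟩)
  have hcard : #(Set.Iio μ.ord) ≤ #T := by
    rw [Cardinal.mk_Iio_ordinal, card_ord]
    exact h.le_mk_of_frequently hT (isSuccLimit_ord hμ.le).isSuccPrelimit
  obtain ⟨e⟩ := hcard
  have he : ∀ γ (hγ : γ < μ.ord), (e ⟨γ, hγ⟩).1 ∈ T := fun γ hγ => (e ⟨γ, hγ⟩).2
  obtain ⟨I, hI, hIcard, hIU⟩ := hgal (fun γ => {k | ∀ hγ : γ < μ.ord, k ∈ W (e ⟨γ, hγ⟩)})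
    fun γ hγ => by filter_upwards [hW _ (hTS (he γ hγ)).1] with k hk _ using hk
  have hinj : Function.Injective fun γ : I => (e ⟨γ.1, hI γ.2⟩).1 := fun x y hxy =>
    Subtype.ext (by simpa using e.injective (Subtype.ext hxy))
  have hsub : Set.range (fun γ : I => (e ⟨γ.1, hI γ.2⟩).1) ⊆ T := by
    rintro _ ⟨γ, rfl⟩
    exact he _ _
  refine ⟨Set.range fun γ : I => (e ⟨γ.1, hI γ.2⟩).1, fun β hβ => (hTS (hsub hβ)).1,
    fun β hβ => (hTS (hsub hβ)).2.1, by rw [mk_range_eq _ hinj, hIcard],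
    fun α hα β hβ => hTc α (hsub hα) β (hsub hβ),
    fun α hα hαA β hβ => (hTS (hsub hβ)).2.2 α hα hαA, ?_⟩
  filter_upwards [hIU] with k hk
  rintro _ ⟨γ, rfl⟩
  exact mem_iInter₂.1 hk γ.1 γ.2 _

end

/-- suppose `ℵ₀ < κ = cf(λ) < λ`, `U` is a normal `κ`-complete
ultrafilter on `κ`, and `⟨λ_i : i < κ⟩` is a strictly increasing cofinal
sequence of regular cardinals in `λ` with `λ_0 > κ` such that each `λ_i`
carries a proper normal filter whose dual ideal contains the sets of size
`< λ_i`, and `Gal(U, λ_i, λ_i)` holds. Then `λ → (λ, ω+1)²`. -/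
theorem partition_from_Galvin (κ lam : Cardinal.{0}) (hunc : ℵ₀ < κ)
    (hcof : κ = lam.ord.cof) (hlt : κ < lam)
    (U : Set (Set Ordinal.{0})) (hU : IsUltraOn κ U) (hUcomp : IsKappaComplete κ U)
    (hUcb : ContainsCobounded κ U) (hUnorm : IsNormalOn κ U)
    (l : Ordinal.{0} → Cardinal.{0})
    (hlreg : ∀ i < κ.ord, (l i).IsRegular)
    (hlmono : ∀ i j : Ordinal, i < j → j < κ.ord → l i < l j)
    (hl0 : κ < l 0)
    (hlub : ∀ i < κ.ord, l i < lam)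
    (hlcof : ∀ μ : Cardinal.{0}, μ < lam → ∃ i < κ.ord, μ ≤ l i)
    (hUi : ∀ i < κ.ord, ∃ Ui : Set (Set Ordinal.{0}),
      IsFilterOn (l i) Ui ∧ IsNormalOn (l i) Ui ∧ SmallSetsInDual (l i) Ui)
    (hgal : ∀ i < κ.ord, GalvinProp U (l i) (l i)) :
    PartitionOmegaSuccRel lam := by
  intro c
  by_contra! hneg
  obtain ⟨hH, hB⟩ := hneg
  have hκlim := isSuccLimit_ord hunc.le
  have h1 : ∀ {j}, j < κ.ord → j + 1 < κ.ord := fun hj => hκlim.add_one_lt hj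
  have h2 : ∀ {j}, j < κ.ord → j + 2 < κ.ord := fun {j} hj => by
    rw [← one_add_one_eq_two, ← add_assoc]
    exact h1 (h1 hj)
  have hlt12 : ∀ {j}, j < κ.ord → l (j + 1) < l (j + 2) := fun {j} hj =>
    hlmono _ _ (by simp) (h2 hj)
  have hl_le : ∀ {i j}, i < j → j < κ.ord → (l (i + 2)).ord ≤ (l (j + 1)).ord := by
    intro i j hij hj
    refine ord_le_ord.2 ?_
    have hle : i + 2 ≤ j + 1 := by
      rw [← one_add_one_eq_two, ← add_assoc]
      exact add_le_add_left (Order.add_one_le_of_lt hij) 1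
    rcases hle.eq_or_lt with h | h
    · rw [h]
    · exact (hlmono _ _ h (h1 hj)).le
  have hκl : ∀ {j}, j < κ.ord → ℵ₀ < l (j + 2) := fun {j} hj =>
    (hunc.trans hl0).trans (hlmono 0 _ (by positivity) (h2 hj))
  have hV : ∀ j, ∃ V : Filter Ordinal.{0}, j < κ.ord → IsNormalAt (l (j + 2)) V := by
    intro j
    by_cases hj : j < κ.ord
    · obtain ⟨F, hF, hFn, hFs⟩ := hUi _ (h2 hj)
      exact ⟨hF.toFilter, fun _ => hF.isNormalAt hFn hFs.containsCobounded⟩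
    · exact ⟨⊥, fun h => absurd h hj⟩
  choose V hV using hV
  let 𝒰 := hU.1.toFilter
  have h𝒰 : IsNormalAt κ 𝒰 := hU.1.isNormalAt hUnorm hUcb
  have := h𝒰.neBot
  have hultra : ∀ A : Set Ordinal.{0}, A ∉ 𝒰 → Aᶜ ∈ 𝒰 := fun A hA => by
    have := (hU.2 (A ∩ Set.Iio κ.ord) inter_subset_right).resolve_left hA
    filter_upwards [hU.1.mem_toFilter_of_mem this] with k hk hkA using hk.2 ⟨hkA, hk.1⟩
  have hgal' : ∀ j < κ.ord, ∀ C : Ordinal.{0} → Set Ordinal.{0},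
      (∀ γ < (l (j + 2)).ord, C γ ∈ 𝒰) → ∃ I ⊆ Set.Iio (l (j + 2)).ord,
        #I = Cardinal.lift.{1, 0} (l (j + 2)) ∧ (⋂ γ ∈ I, C γ) ∈ 𝒰 := by
    intro j hj C hC
    obtain ⟨I, hI, hIcard, hIU⟩ := hgal _ (h2 hj) (fun γ => C γ ∩ Set.Iio κ.ord) hC
    exact ⟨I, hI, hIcard, Filter.mem_of_superset (hU.1.mem_toFilter_of_mem hIU)
      (iInter₂_mono fun _ _ => inter_subset_left)⟩
  obtain ⟨S, hS, hS0⟩ := exists_positive_system hunc h𝒰 hlreg hlmono hlub hV hB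
  let W : Ordinal.{0} → Set Ordinal.{0} := fun α => {k | ∀ᶠ β in V k, β ∈ S k → c α β = 0}
  have hW : ∀ i, ∀ α ∈ S i, W α ∈ 𝒰 := fun i α hα => by
    filter_upwards [hultra _ (hS0 i α hα)] with k hk
    filter_upwards [Filter.not_frequently.1 hk] with β hβ hβS
    by_contra hne
    exact hβ ⟨hβS, by omega⟩
  have hstep : ∀ j, ∃ H : Set Ordinal.{0}, j < κ.ord → (∃ᶠ β in V j, β ∈ S j) →
      (∀ β ∈ H, (l (j + 1)).ord ≤ β ∧ β < (l (j + 2)).ord) ∧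
      #H = Cardinal.lift.{1, 0} (l (j + 2)) ∧ Mono c H 0 ∧
      (∀ α < (l (j + 1)).ord, j ∈ W α → ∀ β ∈ H, c α β = 0) ∧
      ∀ᶠ k in 𝒰, ∀ α ∈ H, k ∈ W α := by
    intro j
    by_cases h : j < κ.ord ∧ ∃ᶠ β in V j, β ∈ S j
    · obtain ⟨H, -, hH⟩ := (hV j h.1).exists_mono_zero_of_galvin (hκl h.1)
        (fun B hBl => hB B (hBl.trans (Set.Iio_subset_Iio (ord_le_ord.2 (hlub _ (h2 h.1)).le))))
        (hgal' j h.1) h.2 (hW j) (ord_lt_ord.2 (hlt12 h.1)) (A := {α | j ∈ W α})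
        (fun α _ hα => hα)
      exact ⟨H, fun _ _ => hH⟩
    · exact ⟨∅, fun h' h'' => absurd ⟨h', h''⟩ h⟩
  choose H hHspec using hstep
  have hdiag := h𝒰.diag (fun i k => (∃ᶠ β in V i, β ∈ S i) → ∀ α ∈ H i, k ∈ W α) fun i hi => by
    by_cases hSi : ∃ᶠ β in V i, β ∈ S i
    · simpa only [hSi, forall_true_left] using (hHspec i hi hSi).2.2.2.2
    · simp [hSi]
  let D : Set Ordinal.{0} := {k | k < κ.ord ∧ (∃ᶠ β in V k, β ∈ S k) ∧
    ∀ i < k, (∃ᶠ β in V i, β ∈ S i) → ∀ α ∈ H i, k ∈ W α}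
  have hD : ∀ᶠ k in 𝒰, k ∈ D := h𝒰.lt.and (hS.and hdiag)
  have hbd : ∀ k ∈ D, ∀ β ∈ H k, (l (k + 1)).ord ≤ β ∧ β < (l (k + 2)).ord :=
    fun k hk => (hHspec k hk.1 hk.2.1).1
  have hsub : (⋃ k ∈ D, H k) ⊆ Set.Iio lam.ord := iUnion₂_subset fun k hk β hβ =>
    (hbd k hk β hβ).2.trans (ord_lt_ord.2 (hlub _ (h2 hk.1)))
  refine hH (⋃ k ∈ D, H k) hsub (le_antisymm ?_ ?_) ?_
  · refine (mk_le_mk_of_subset hsub).trans_eq ?_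
    rw [Cardinal.mk_Iio_ordinal, card_ord]
  · by_contra! hlt'
    obtain ⟨μ, hμ, hμeq⟩ := Cardinal.lt_lift_iff.1 hlt'
    obtain ⟨i, hi, hμi⟩ := hlcof μ hμ
    obtain ⟨k, hkD, hik⟩ := (hD.and (h𝒰.ge i hi)).exists
    have hle : #(H k) ≤ Cardinal.lift.{1, 0} μ :=
      hμeq ▸ mk_le_mk_of_subset (subset_biUnion_of_mem (u := H) hkD)
    rw [(hHspec k hkD.1 hkD.2.1).2.1, Cardinal.lift_le] at hle
    have : l i < l (k + 2) := hlmono _ _ (hik.trans_lt (by simp)) (h2 hkD.1)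
    exact (hle.trans hμi).not_gt this
  · intro α hα β hβ hαβ
    obtain ⟨i, hiD, hαi⟩ := mem_iUnion₂.1 hα
    obtain ⟨j, hjD, hβj⟩ := mem_iUnion₂.1 hβ
    obtain ⟨-, -, hmono, hcross, -⟩ := hHspec j hjD.1 hjD.2.1
    rcases lt_trichotomy i j with hij | rfl | hji
    · exact hcross α ((hbd i hiD α hαi).2.trans_le (hl_le hij hjD.1))
        (hjD.2.2 i hij hiD.2.1 α hαi) β hβj
    · exact hmono α hαi β hβj hαβ
    · exact absurd hαβ (((hbd j hjD β hβj).2.le.trans (hl_le hji hiD.1)).trans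
        (hbd i hiD α hαi).1).not_gt
end
end
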